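/- arXiv:2309.13034 — 6 statements merged into one kernel-verified Lean document; each statement's English description precedes it below -/
import Mathlib

section
/- Let G be a finite simple graph and v a vertex of G such that i(G) > i(G − v). Then i(G − N[v]) = i(G) − 1, where N[v] = N_G(v) ∪ {v}. -/
/-- `S` is an independent set of `G`: no two of its vertices are adjacent. -/
def IsIndep {V : Type*} (G : SimpleGraph V) (S : Set V) : Prop :=
  S.Pairwise fun u w => ¬ G.Adj u w

/-- `S` is a maximal independent set of `G`: it is independent and is not properly
contained in another independent set of `G`. -/
def IsMaxIndep {V : Type*} (G : SimpleGraph V) (S : Set V) : Prop :=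
  IsIndep G S ∧ ∀ T : Set V, IsIndep G T → S ⊆ T → S = T

/-- `i(G)`: the minimum cardinality of a maximal independent set of `G`. -/
noncomputable def indepDomNum {V : Type*} (G : SimpleGraph V) : ℕ :=
  sInf {n | ∃ S : Set V, IsMaxIndep G S ∧ S.ncard = n}

theorem isMaxIndep_iff {V : Type*} {G : SimpleGraph V} {S : Set V} :
    IsMaxIndep G S ↔ IsIndep G S ∧ ∀ w ∉ S, ∃ u ∈ S, G.Adj u w := by
  refine and_congr_right fun hS => ⟨fun hmax w hw => ?_, fun hdom T hT hST => ?_⟩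
  · by_contra! hna
    refine hw ?_
    rw [hmax (insert w S) (hS.insert fun u hu _ => ⟨fun h => hna u hu h.symm, hna u hu⟩)
      (Set.subset_insert w S)]
    exact Set.mem_insert w S
  · refine hST.antisymm fun w hw => ?_
    by_contra hwS
    obtain ⟨u, hu, huw⟩ := hdom w hwS
    exact hT (hST hu) hw huw.ne huw

theorem indepDomNum_le {V : Type*} {G : SimpleGraph V} {S : Set V} (hS : IsMaxIndep G S) :
    indepDomNum G ≤ S.ncard :=
  Nat.sInf_le ⟨S, hS, rfl⟩

theorem exists_isMaxIndep {V : Type*} [Finite V] (G : SimpleGraph V) :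
    ∃ S, IsMaxIndep G S := by
  obtain ⟨S, hS⟩ := (Set.toFinite {S : Set V | IsIndep G S}).exists_maximal
    ⟨∅, Set.pairwise_empty _⟩
  exact ⟨S, hS.prop, fun T hT hST => hS.eq_of_subset hT hST⟩

theorem exists_isMaxIndep_ncard_eq {V : Type*} [Finite V] (G : SimpleGraph V) :
    ∃ S, IsMaxIndep G S ∧ S.ncard = indepDomNum G := by
  obtain ⟨S, hS⟩ := exists_isMaxIndep G
  exact Nat.sInf_mem (s := {n | ∃ S : Set V, IsMaxIndep G S ∧ S.ncard = n}) ⟨_, S, hS, rfl⟩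

/-- A maximal independent set of an induced subgraph, described in the ambient graph. -/
theorem isMaxIndep_induce_iff {V : Type*} {G : SimpleGraph V} {s : Set V} {S : Set s} :
    IsMaxIndep (G.induce s) S ↔ IsIndep G (Subtype.val '' S) ∧
      ∀ w ∈ s, w ∉ Subtype.val '' S → ∃ u ∈ Subtype.val '' S, G.Adj u w := by
  rw [isMaxIndep_iff]
  refine and_congr ?_ ?_
  · exact (Subtype.val_injective.injOn.pairwise_image
      (r := fun u w => ¬ G.Adj u w)).symm
  · refine Subtype.forall.trans (forall₂_congr fun w hw => ?_)
    simp [hw]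

theorem indepDomNum_induce_le {V : Type*} {G : SimpleGraph V} {s T : Set V} (hTs : T ⊆ s)
    (hT : IsIndep G T) (hdom : ∀ w ∈ s, w ∉ T → ∃ u ∈ T, G.Adj u w) :
    indepDomNum (G.induce s) ≤ T.ncard := by
  obtain ⟨S, rfl⟩ : ∃ S : Set s, Subtype.val '' S = T :=
    ⟨Subtype.val ⁻¹' T, by rwa [Subtype.image_preimage_coe, Set.inter_eq_right]⟩
  rw [Set.ncard_image_of_injective _ Subtype.val_injective]
  exact indepDomNum_le (isMaxIndep_induce_iff.2 ⟨hT, hdom⟩)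

theorem exists_ncard_eq_indepDomNum_induce {V : Type*} [Finite V] (G : SimpleGraph V)
    (s : Set V) :
    ∃ T ⊆ s, IsIndep G T ∧ (∀ w ∈ s, w ∉ T → ∃ u ∈ T, G.Adj u w) ∧
      T.ncard = indepDomNum (G.induce s) := by
  obtain ⟨S, hS, hcard⟩ := exists_isMaxIndep_ncard_eq (G.induce s)
  obtain ⟨hind, hdom⟩ := isMaxIndep_induce_iff.1 hS
  exact ⟨Subtype.val '' S, Subtype.coe_image_subset s S, hind, hdom,
    by rw [Set.ncard_image_of_injective _ Subtype.val_injective, hcard]⟩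

theorem indepDomNum_le_delete_closedNbhd_add_one {V : Type*} [Finite V] (G : SimpleGraph V)
    (v : V) :
    indepDomNum G ≤ indepDomNum (G.induce ((G.neighborSet v ∪ {v})ᶜ : Set V)) + 1 := by
  obtain ⟨T, hTs, hT, hdom, hcard⟩ :=
    exists_ncard_eq_indepDomNum_induce G (G.neighborSet v ∪ {v})ᶜ
  have hnadj : ∀ u ∈ T, ¬ G.Adj v u := fun u hu h => hTs hu (Or.inl h)
  rw [← hcard]
  refine (indepDomNum_le (S := insert v T) (isMaxIndep_iff.2 ⟨?_, fun w hw => ?_⟩)).trans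
    (Set.ncard_insert_le v T)
  · exact hT.insert fun u hu _ => ⟨hnadj u hu, fun h => hnadj u hu h.symm⟩
  · rw [Set.mem_insert_iff, not_or] at hw
    by_cases hvw : G.Adj v w
    · exact ⟨v, Set.mem_insert v T, hvw⟩
    · obtain ⟨u, hu, huw⟩ := hdom w (fun h => h.elim hvw hw.1) hw.2
      exact ⟨u, Set.mem_insert_of_mem v hu, huw⟩

theorem indepDomNum_delete_closedNbhd_le {V : Type*} [Finite V] (G : SimpleGraph V) (v : V)
    (h : indepDomNum (G.induce ({v}ᶜ : Set V)) < indepDomNum G) :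
    indepDomNum (G.induce ((G.neighborSet v ∪ {v})ᶜ : Set V)) ≤
      indepDomNum (G.induce ({v}ᶜ : Set V)) := by
  obtain ⟨T, hTs, hT, hdom, hcard⟩ := exists_ncard_eq_indepDomNum_induce G {v}ᶜ
  have hnadj : ∀ u ∈ T, ¬ G.Adj u v := by
    intro u hu huv
    refine (hcard ▸ h).not_ge (indepDomNum_le (isMaxIndep_iff.2 ⟨hT, fun w hw => ?_⟩))
    by_cases hwv : w = v
    · exact ⟨u, hu, hwv ▸ huv⟩
    · exact hdom w hwv hw
  rw [← hcard]
  exact indepDomNum_induce_le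
    (fun u hu hmem => hmem.elim (fun hvu => hnadj u hu hvu.symm) (hTs hu)) hT
    fun w hw => hdom w fun hwv => hw (Or.inr hwv)

/-- If `v` is a vertex of a finite simple graph `G` with `i(G) > i(G - v)`, then
`i(G - N[v]) = i(G) - 1`, where `N[v] = N_G(v) ∪ {v}`. -/
theorem indepDomNum_delete_closedNbhd_eq
    {V : Type*} [Fintype V] (G : SimpleGraph V) (v : V)
    (h : indepDomNum (G.induce ({v}ᶜ : Set V)) < indepDomNum G) :
    indepDomNum (G.induce ((G.neighborSet v ∪ {v})ᶜ : Set V)) = indepDomNum G - 1 := by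
  have hle := indepDomNum_delete_closedNbhd_le G v h
  have hge := indepDomNum_le_delete_closedNbhd_add_one G v
  omega
end

section
/- Let K be a field, n ≥ 2 an integer, and d, p natural numbers satisfying 1 ≤ p ≤ d ≤ n − 1 and d ≤ (n − d)(d − p + 1). Then there exists a finite simple connected graph G on n vertices such that the Krull dimension of R/I(G) equals d and the depth of R/I(G) equals p, where I(G) ⊆ R = K[x_1, …, x_n] is the edge ideal of G and depth denotes the depth of the localization of R/I(G) at the irrelevant maximal ideal generated by the images of the variables. -/
open MvPolynomial

/-- The edge ideal `I(G)` of a graph `G`: the ideal of `K[x_w : w ∈ V(G)]` generated by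
the monomials `x_u * x_w` for all edges `{u, w}` of `G`. -/
noncomputable def edgeIdeal (K : Type*) [Field K] {V : Type*} (G : SimpleGraph V) :
    Ideal (MvPolynomial V K) :=
  Ideal.span {m | ∃ u w, G.Adj u w ∧ m = X u * X w}

set_option synthInstance.maxHeartbeats 1000000

/-- The depth of `R/I(G)` (with respect to the irrelevant maximal ideal generated by the
images of all the variables): the common length of maximal regular sequences on `R/I(G)`
contained in that maximal ideal, expressed as the supremum of the lengths of such
regular sequences. -/
noncomputable def edgeRingDepth (K : Type*) [Field K] {V : Type*} (G : SimpleGraph V) : ℕ :=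
  sSup {n | ∃ rs : List (MvPolynomial V K ⧸ edgeIdeal K G),
    rs.length = n ∧
    (∀ r ∈ rs, r ∈ Ideal.span
      (Set.range fun w => Ideal.Quotient.mk (edgeIdeal K G) (X w))) ∧
    RingTheory.Sequence.IsRegular (MvPolynomial V K ⧸ edgeIdeal K G) rs}

section
open scoped Pointwise
variable {R M : Type*} [CommRing R] [AddCommGroup M] [Module R M]

theorem exists_colon_smul_top_le [IsNoetherianRing R] [Module.Finite R M] {𝔪 P : Ideal R}
    [h𝔪 : 𝔪.IsPrime] (hP : P ≤ 𝔪) {a : R} (ha : a ∈ 𝔪) (hreg : IsSMulRegular M a) {x : M}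
    (hx : P = (⊥ : Submodule R M).colon {x}) :
    ∃ z : M, (∀ r ∈ P, r • z = 0) ∧ (a • (⊤ : Submodule R M)).colon {z} ≤ 𝔪 := by
  classical
  let N : Submodule R M := Submodule.torsionBySet R M P
  have hN : ∀ z, z ∈ N ↔ ∀ r ∈ P, r • z = 0 := fun z ↦ by
    simp [N, Submodule.mem_torsionBySet_iff]
  obtain ⟨S, hS⟩ : N.FG := IsNoetherian.noetherian N
  by_contra! hcon
  have hcolon : ¬ S.inf (fun z ↦ (a • (⊤ : Submodule R M)).colon {z}) ≤ 𝔪 := by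
    rw [h𝔪.inf_le']
    rintro ⟨z, hz, hz'⟩
    exact hcon z ((hN z).1 (hS ▸ Submodule.subset_span hz)) hz'
  obtain ⟨s, hs, hs𝔪⟩ := SetLike.not_le_iff_exists.1 hcolon
  have hsN : ∀ z ∈ N, s • z ∈ a • (⊤ : Submodule R M) := by
    intro z hz
    rw [← hS] at hz
    induction hz using Submodule.span_induction with
    | mem z hz =>
      exact Submodule.mem_colon_singleton.1 (Submodule.mem_finsetInf.1 hs z hz)
    | zero => simp
    | add u v _ _ hu hv => rw [smul_add]; exact add_mem hu hv
    | smul r u _ hu => rw [smul_comm]; exact Submodule.smul_mem _ _ hu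
  have hrange : LinearMap.range (s • (LinearMap.id : N →ₗ[R] N)) ≤
      Ideal.span {a} • (⊤ : Submodule R N) := by
    rintro _ ⟨⟨z, hz⟩, rfl⟩
    obtain ⟨w, -, hw⟩ := hsN z hz
    have hw : a • w = s • z := hw
    have hwN : w ∈ N := by
      rw [hN] at hz ⊢
      intro r hr
      apply hreg
      simp only [smul_zero]
      rw [smul_comm, hw, smul_comm, hz r hr, smul_zero]
    have : (s • (LinearMap.id : N →ₗ[R] N)) ⟨z, hz⟩ = a • (⟨w, hwN⟩ : N) := by
      ext; exact hw.symm
    rw [this]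
    exact Submodule.smul_mem_smul (Ideal.mem_span_singleton_self a) trivial
  obtain ⟨p, hp, -, hcoeff, hp0⟩ :=
    LinearMap.exists_monic_and_natDegree_eq_and_coeff_mem_pow_and_aeval_eq_zero R
      (s • (LinearMap.id : N →ₗ[R] N)) _ hrange
  have hxN : x ∈ N := (hN x).2 fun r hr ↦ by
    rw [hx, Submodule.mem_colon_singleton] at hr; simpa using hr
  have hps : p.eval s ∈ P := by
    rw [hx, Submodule.mem_colon_singleton, Submodule.mem_bot]
    have h1 := congrArg (fun f : N →ₗ[R] N ↦ ((f ⟨x, hxN⟩ : N) : M)) hp0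
    have h2 : (s • (LinearMap.id : N →ₗ[R] N)) = algebraMap R (Module.End R N) s := rfl
    simp only [h2, Polynomial.aeval_algebraMap_apply] at h1
    simpa [Module.algebraMap_end_apply] using h1
  have hpm := hP hps
  have hsum : p.eval s - s ^ p.natDegree ∈ 𝔪 := by
    have heval : p.eval s = s ^ p.natDegree +
        ∑ k ∈ Finset.range p.natDegree, p.coeff k * s ^ k := by
      conv_lhs => rw [hp.as_sum]
      simp [Polynomial.eval_finsetSum]
    rw [heval, add_sub_cancel_left]
    refine sum_mem fun k hk ↦ Ideal.mul_mem_right _ _ ?_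
    have hk : p.natDegree - k ≠ 0 := by have := Finset.mem_range.1 hk; omega
    exact ((Ideal.pow_le_self hk).trans ((Ideal.span_singleton_le_iff_mem _).2 ha)) (hcoeff k)
  exact hs𝔪 (h𝔪.mem_of_pow_mem _ ((Submodule.sub_mem_iff_right _ hpm).1 hsum))

theorem length_le_coheight_of_isWeaklyRegular [IsNoetherianRing R] {𝔪 : Ideal R} [h𝔪 : 𝔪.IsPrime]
    (rs : List R) : ∀ {M : Type*} [AddCommGroup M] [Module R M] [Module.Finite R M],
    (∀ r ∈ rs, r ∈ 𝔪) → RingTheory.Sequence.IsWeaklyRegular M rs →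
    ∀ (P : PrimeSpectrum R), P.asIdeal ≤ 𝔪 → ∀ x : M, P.asIdeal = (⊥ : Submodule R M).colon {x} →
    (rs.length : ℕ∞) ≤ Order.coheight P := by
  induction rs with
  | nil => simp
  | cons a rs ih =>
    intro M _ _ _ hrs hreg P hP x hx
    rw [RingTheory.Sequence.isWeaklyRegular_cons_iff] at hreg
    obtain ⟨z, hPz, hz⟩ := exists_colon_smul_top_le hP (hrs a (by simp)) hreg.1 hx
    let z' : QuotSMulTop a M := Submodule.Quotient.mk z
    have hz' : (⊥ : Submodule R (QuotSMulTop a M)).colon {z'} ≤ 𝔪 := by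
      refine le_trans (fun r hr ↦ ?_) hz
      rw [Submodule.mem_colon_singleton] at hr ⊢
      exact (Submodule.Quotient.mk_eq_zero _).1 hr
    obtain ⟨Q, hQ, hQ𝔪⟩ := Ideal.exists_minimalPrimes_le hz'
    obtain ⟨w, hw⟩ := Submodule.exists_eq_colon_of_mem_minimalPrimes hQ
    have hle : (⊥ : Submodule R (QuotSMulTop a M)).colon {z'} ≤ Q := hQ.1.2
    let Q' : PrimeSpectrum R := ⟨Q, hQ.1.1⟩
    have haQ : a ∈ Q := hle <| by
      rw [Submodule.mem_colon_singleton, Submodule.mem_bot]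
      exact (Submodule.Quotient.mk_eq_zero _).2 (Submodule.smul_mem_pointwise_smul _ _ _ trivial)
    have hx0 : x ≠ 0 := by
      rintro rfl
      exact P.2.ne_top (by rw [hx]; ext; simp [Submodule.mem_colon_singleton])
    have haP : a ∉ P.asIdeal := by
      rw [hx, Submodule.mem_colon_singleton, Submodule.mem_bot]
      exact fun h ↦ hx0 (hreg.1 (by simpa using h))
    have hPQ : P.asIdeal ≤ Q := fun r hr ↦ hle <| by
      rw [Submodule.mem_colon_singleton, Submodule.mem_bot]
      change Submodule.Quotient.mk (r • z) = 0
      rw [hPz r hr]; rfl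
    have hlt : P < Q' := lt_of_le_of_ne hPQ fun h ↦ haP (h ▸ haQ)
    have := ih (M := QuotSMulTop a M) (fun r hr ↦ hrs r (by simp [hr])) hreg.2 Q' hQ𝔪 w hw
    calc ((a :: rs).length : ℕ∞) = rs.length + 1 := by simp
      _ ≤ Order.coheight Q' + 1 := by gcongr
      _ ≤ _ := Order.coheight_add_one_le hlt
end

theorem coheight_le_ringKrullDim_of_ker_le {R S : Type*} [CommRing R] [CommRing S] (f : R →+* S)
    (hf : Function.Surjective f) (q : PrimeSpectrum R) (hq : RingHom.ker f ≤ q.asIdeal) :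
    (Order.coheight q : WithBot ℕ∞) ≤ ringKrullDim S := by
  rw [Order.coheight_eq_krullDim_Ici]
  have hker (r : Set.Ici q) : RingHom.ker f ≤ r.1.asIdeal := hq.trans r.2
  let g : Set.Ici q → PrimeSpectrum S := fun r ↦
    ⟨r.1.asIdeal.map f, Ideal.map_isPrime_of_surjective hf (hker r)⟩
  have hg (r : Set.Ici q) : (g r).asIdeal.comap f = r.1.asIdeal := by
    simp only [g, Ideal.comap_map_of_surjective f hf]
    exact sup_eq_left.2 (hker r)
  refine Order.krullDim_le_of_strictMono g (Monotone.strictMono_of_injective ?_ ?_)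
  · exact fun r s h ↦ Ideal.map_mono h
  · intro r s h
    ext1; ext1
    rw [← hg r, ← hg s, h]

theorem isWeaklyRegular_ofFn_X (K : Type*) [Field K] (p : ℕ) :
    RingTheory.Sequence.IsWeaklyRegular (MvPolynomial (Fin p) K)
      (List.ofFn (X : Fin p → MvPolynomial (Fin p) K)) := by
  refine ⟨fun i hi ↦ ?_⟩
  have hip : i < p := by simpa using hi
  have key : Ideal.ofList ((List.ofFn (X : Fin p → MvPolynomial (Fin p) K)).take i) =
      Ideal.span (X '' {j : Fin p | j.val < i}) := by
    rw [Ideal.ofList]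
    congr 1
    ext f
    simp only [List.mem_take_iff_getElem, List.getElem_ofFn, List.length_ofFn, Set.mem_ofPred_eq,
      Set.mem_image]
    constructor
    · rintro ⟨j, hj, rfl⟩
      exact ⟨⟨j, by omega⟩, by simp; omega, rfl⟩
    · rintro ⟨j, hj, rfl⟩
      exact ⟨j, by omega, rfl⟩
  rw [List.getElem_ofFn, key]
  rw [isSMulRegular_iff_right_eq_zero_of_smul]
  intro y hy
  obtain ⟨f, rfl⟩ := Submodule.Quotient.mk_surjective _ y
  rw [← Submodule.Quotient.mk_smul, Submodule.Quotient.mk_eq_zero] at hy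
  rw [Submodule.Quotient.mk_eq_zero]
  simp only [smul_eq_mul, Ideal.mul_top, mem_ideal_span_X_image] at hy ⊢
  intro m hm
  obtain ⟨j, hj, hjm⟩ := hy (Finsupp.single ⟨i, hip⟩ 1 + m) (by
    rw [mem_support_iff, coeff_X_mul]; exact mem_support_iff.1 hm)
  refine ⟨j, hj, ?_⟩
  rwa [Finsupp.add_apply, Finsupp.single_eq_of_ne, zero_add] at hjm
  rintro rfl
  simp at hj

section Filtration
variable {ι T B S : Type*} [CommRing T] [CommRing B] [CommRing S]

theorem ker_eq_colon_of_mul_eq [IsDomain T] {y : B} {φ : T →+* B} {ψ : B →+* T}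
    (hψ : ψ y ≠ 0) (hy : ∀ b, y * b = y * φ (ψ b)) :
    RingHom.ker ψ = (⊥ : Ideal B).colon {y} := by
  ext b
  rw [Submodule.mem_colon_singleton, Submodule.mem_bot, smul_eq_mul, mul_comm, RingHom.mem_ker]
  constructor
  · intro h
    rw [hy, h, map_zero, mul_zero]
  · intro h
    simpa [hψ] using congrArg ψ h

theorem ker_le_or_exists_ker_le [IsDomain T] {y : ι → B} {φ : T →+* B} {ψ : ι → B →+* T}
    {β : B →+* S} {σ : S →+* B} (hJ : ∀ b, b - σ (β b) ∈ Ideal.span (Set.range y))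
    (hy : ∀ i b, y i * b = y i * φ (ψ i b)) (q : Ideal B) [hq : q.IsPrime] :
    RingHom.ker β ≤ q ∨ ∃ i, RingHom.ker (ψ i) ≤ q := by
  by_cases h : ∀ i, y i ∈ q
  · left
    intro b hb
    have := hJ b
    rw [RingHom.mem_ker.1 hb, map_zero, sub_zero] at this
    exact Ideal.span_le.2 (Set.range_subset_iff.2 h) this
  · right
    push Not at h
    obtain ⟨i, hi⟩ := h
    refine ⟨i, fun b hb ↦ (hq.mem_or_mem (?_ : y i * b ∈ q)).resolve_left hi⟩
    rw [hy, RingHom.mem_ker.1 hb, map_zero, mul_zero]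
    exact zero_mem q

theorem flat_of_section [Fintype ι] [IsDomain T] [Algebra T B] [Algebra T S] [Module.Free T S]
    {y : ι → B} {ψ : ι → B →ₐ[T] T} {β : B →ₐ[T] S} {σ : S →ₐ[T] B}
    (hβσ : ∀ s, β (σ s) = s) (hβy : ∀ i, β (y i) = 0)
    (hJ : ∀ b, b - σ (β b) ∈ Ideal.span (Set.range y))
    (hψ : ∀ i j, j ≠ i → ψ i (y j) = 0) (hψ' : ∀ i, ψ i (y i) ≠ 0)
    (hy : ∀ i b, y i * b = y i * algebraMap T B (ψ i b)) : Module.Flat T B := by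
  classical
  let f : ((ι → T) × S) →ₗ[T] B :=
    (Fintype.linearCombination T y).coprod σ.toLinearMap
  have hf (c : ι → T) (s : S) : f (c, s) = ∑ i, c i • y i + σ s := by
    simp [f, Fintype.linearCombination_apply]
  have hβf (c : ι → T) (s : S) : β (f (c, s)) = s := by
    simp [hf, hβy, hβσ]
  have hinj : Function.Injective f := by
    rw [← LinearMap.ker_eq_bot, LinearMap.ker_eq_bot']
    rintro ⟨c, s⟩ h
    obtain rfl : s = 0 := by rw [← hβf c s, h, map_zero]
    have : c = 0 := by
      funext i
      have := congrArg (ψ i) h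
      rw [hf, map_add, map_zero, map_zero, add_zero, map_sum,
        Finset.sum_eq_single i (by intro j _ hj; simp [hψ i j hj]) (by simp)] at this
      simpa [hψ'] using this
    rw [this]; rfl
  have hsurj : Function.Surjective f := by
    intro b
    obtain ⟨c, hc⟩ := Submodule.mem_span_range_iff_exists_fun B |>.1 (hJ b)
    refine ⟨(fun i ↦ ψ i (c i), β b), ?_⟩
    rw [hf, ← eq_sub_iff_add_eq, ← hc]
    refine Finset.sum_congr rfl fun i _ ↦ ?_
    rw [smul_eq_mul, mul_comm, hy, Algebra.smul_def, mul_comm]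
  have := Module.Free.of_equiv (LinearEquiv.ofBijective f ⟨hinj, hsurj⟩)
  infer_instance

end Filtration

/-- The element of residue `c` modulo `k` in the `i`-th transversal of the residue classes
modulo `k` in `{0, …, d - 1}`. -/
def residueTransversal (d k i c : ℕ) : ℕ := if i * k + c < d then i * k + c else c

theorem residueTransversal_mod {d k i c : ℕ} (hc : c < k) :
    residueTransversal d k i c % k = c := by
  unfold residueTransversal
  split_ifs
  · rw [Nat.mul_add_mod_self_right, Nat.mod_eq_of_lt hc]
  · exact Nat.mod_eq_of_lt hc

theorem residueTransversal_lt {d k i c : ℕ} (hc : c < k) (hkd : k ≤ d) :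
    residueTransversal d k i c < d := by
  unfold residueTransversal
  split_ifs <;> omega

universe u

/-- The `K`-algebra `B` is presented by generators `x a` for `a < d` and `y i`, subject to the
relations `y i * y j = 0` for `i ≠ j` and `y i * x a = 0` for `a` in the `i`-th transversal of the
residue classes modulo `k`. -/
structure IsTransversalPresentation (K : Type u) {B : Type u} [Field K] [CommRing B] [Algebra K B]
    (d k : ℕ) {m : ℕ} (x : ℕ → B) (y : Fin m → B) : Prop where
  y_mul_y : ∀ i j, i ≠ j → y i * y j = 0
  y_mul_x : ∀ (i : Fin m) (a), a < d → residueTransversal d k i (a % k) = a → y i * x a = 0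
  adjoin_eq_top : Algebra.adjoin K (x '' Set.Iio d ∪ Set.range y) = ⊤
  exists_lift : ∀ (S : Type u) [CommRing S] [Algebra K S] (x' : ℕ → S) (y' : Fin m → S),
    (∀ i j, i ≠ j → y' i * y' j = 0) →
    (∀ (i : Fin m) (a), a < d → residueTransversal d k i (a % k) = a → y' i * x' a = 0) →
    ∃ f : B →ₐ[K] S, (∀ a < d, f (x a) = x' a) ∧ ∀ i, f (y i) = y' i

/-- The variable of the parameter ring attached to an index `a` with `k ≤ a < k + q`, and zero for
other `a`. -/
noncomputable def paramVar (K : Type u) [Field K] (k q a : ℕ) : MvPolynomial (Fin (q + 1)) K :=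
  if h : k ≤ a ∧ a < k + q then X (Fin.succ ⟨a - k, by omega⟩) else 0

/-- The map from a polynomial ring whose images of the variables form a regular sequence. -/
noncomputable def paramHom (K : Type u) {B : Type u} [Field K] [CommRing B] [Algebra K B]
    (k q : ℕ) {m : ℕ} (x : ℕ → B) (y : Fin m → B) : MvPolynomial (Fin (q + 1)) K →ₐ[K] B :=
  aeval (Fin.cons (x 0 + ∑ i, y i) fun t : Fin q ↦ x (k + t) + x ((k + t) % k))

section
variable {K : Type u} {B : Type u} [Field K] [CommRing B] [Algebra K B]
  {k q m : ℕ} {x : ℕ → B} {y : Fin m → B}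

@[simp] theorem paramHom_X_zero : paramHom K k q x y (X 0) = x 0 + ∑ i, y i := by
  simp [paramHom]

@[simp] theorem paramHom_X_succ (t : Fin q) :
    paramHom K k q x y (X t.succ) = x (k + t) + x ((k + t) % k) := by
  simp [paramHom]

theorem paramHom_paramVar {a : ℕ} (h : k ≤ a) (h' : a < k + q) :
    paramHom K k q x y (paramVar K k q a) = x a + x (a % k) := by
  rw [paramVar, dif_pos ⟨h, h'⟩, paramHom_X_succ]
  simp only [Nat.add_sub_cancel' h]

theorem paramVar_add (t : Fin q) : paramVar K k q (k + t) = X t.succ := by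
  rw [paramVar, dif_pos ⟨by omega, by omega⟩]
  congr 2
  simp

theorem paramVar_of_lt {a : ℕ} (h : a < k) : paramVar K k q a = 0 := by
  rw [paramVar, dif_neg (by omega)]

theorem constantCoeff_paramVar (a : ℕ) : constantCoeff (paramVar K k q a) = 0 := by
  unfold paramVar
  split_ifs <;> simp

theorem X_zero_sub_paramVar_ne_zero (a : ℕ) : (X 0 : MvPolynomial (Fin (q + 1)) K) -
    paramVar K k q a ≠ 0 := by
  rw [sub_ne_zero, paramVar]
  split_ifs
  · intro h
    exact Fin.succ_ne_zero _ (X_injective h).symm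
  · exact X_ne_zero 0

namespace IsTransversalPresentation

theorem induction_on {d : ℕ} (h : IsTransversalPresentation K d k x y) {P : B → Prop} (b : B)
    (hx : ∀ a < d, P (x a)) (hy : ∀ i, P (y i)) (hC : ∀ r : K, P (algebraMap K B r))
    (hadd : ∀ b c, P b → P c → P (b + c)) (hmul : ∀ b c, P b → P c → P (b * c)) : P b := by
  have hb : b ∈ Algebra.adjoin K (x '' Set.Iio d ∪ Set.range y) := by
    rw [h.adjoin_eq_top]; trivial
  induction hb using Algebra.adjoin_induction with
  | mem b hb =>
    rcases hb with ⟨a, ha, rfl⟩ | ⟨i, rfl⟩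
    · exact hx a ha
    · exact hy i
  | algebraMap r => exact hC r
  | add b c _ _ hb hc => exact hadd b c hb hc
  | mul b c _ _ hb hc => exact hmul b c hb hc

variable (h : IsTransversalPresentation K (k + q) k x y)
include h

theorem y_mul_paramHom_paramVar (i : Fin m) {c : ℕ} (hc : c < k) :
    y i * paramHom K k q x y (paramVar K k q (residueTransversal (k + q) k i c)) = y i * x c := by
  have hmod := residueTransversal_mod (d := k + q) (i := i) hc
  have hlt := residueTransversal_lt (i := i) hc (Nat.le_add_right k q)
  generalize hr : residueTransversal (k + q) k i c = r at hmod hlt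
  have hzero : y i * x r = 0 := h.y_mul_x i r hlt (by rw [hmod, hr])
  rcases lt_or_ge r k with hrk | hrk
  · obtain rfl : r = c := by rw [← hmod, Nat.mod_eq_of_lt hrk]
    rw [paramVar_of_lt hrk, map_zero, mul_zero, hzero]
  · rw [paramHom_paramVar hrk hlt, hmod, mul_add, hzero, zero_add]

theorem exists_transversalHom (hk : 0 < k) (i : Fin m) :
    ∃ ψ : B →ₐ[K] MvPolynomial (Fin (q + 1)) K,
      (∀ t, ψ (paramHom K k q x y t) = t) ∧ (∀ j, j ≠ i → ψ (y j) = 0) ∧ ψ (y i) ≠ 0 ∧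
      (∀ b, y i * b = y i * paramHom K k q x y (ψ b)) ∧
      (∀ a < k + q, constantCoeff (ψ (x a)) = 0) ∧ ∀ j, constantCoeff (ψ (y j)) = 0 := by
  let w : ℕ → MvPolynomial (Fin (q + 1)) K := fun c ↦
    paramVar K k q (residueTransversal (k + q) k i c)
  have hyw {c : ℕ} (hc : c < k) : y i * paramHom K k q x y (w c) = y i * x c :=
    h.y_mul_paramHom_paramVar i hc
  have hw0 (c : ℕ) : constantCoeff (w c) = 0 := constantCoeff_paramVar _
  obtain ⟨ψ, hψx, hψy⟩ := h.exists_lift (MvPolynomial (Fin (q + 1)) K)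
    (fun a ↦ if a < k then w a else paramVar K k q a - w (a % k))
    (fun j ↦ if j = i then X 0 - w 0 else 0)
    (fun j l hjl ↦ by
      by_cases hj : j = i
      · have hl : l ≠ i := hj ▸ hjl.symm
        simp only [if_neg hl, mul_zero]
      · simp only [if_neg hj, zero_mul])
    (fun j a ha haj ↦ by
      by_cases hj : j = i
      · subst hj
        by_cases hak : a < k
        · rw [Nat.mod_eq_of_lt hak] at haj
          simp only [if_pos hak, w, haj, paramVar_of_lt hak, mul_zero]
        · simp only [if_neg hak, w, haj, sub_self, mul_zero]
      · simp only [if_neg hj, zero_mul])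
  have hψx₁ {a : ℕ} (ha : a < k) : ψ (x a) = w a := by
    rw [hψx a (by omega), if_pos ha]
  have hψx₂ {a : ℕ} (ha : k ≤ a) (ha' : a < k + q) : ψ (x a) = paramVar K k q a - w (a % k) := by
    rw [hψx a ha', if_neg (by omega)]
  have hψi : ψ (y i) = X 0 - w 0 := by rw [hψy, if_pos rfl]
  have hψj {j : Fin m} (hj : j ≠ i) : ψ (y j) = 0 := by rw [hψy, if_neg hj]
  have hsum (b : Fin m → B) (hb : ∀ j, j ≠ i → b j = 0) : ∑ j, b j = b i :=
    Finset.sum_eq_single i (fun j _ hj ↦ hb j hj) (by simp)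
  refine ⟨ψ, fun t ↦ ?_, fun j hj ↦ hψj hj, ?_, fun b ↦ ?_, fun a ha ↦ ?_, fun j ↦ ?_⟩
  · have : (ψ.comp (paramHom K k q x y)) = AlgHom.id K _ := by
      refine MvPolynomial.algHom_ext fun s ↦ ?_
      refine Fin.cases ?_ (fun s ↦ ?_) s
      · rw [AlgHom.comp_apply, paramHom_X_zero, map_add, map_sum,
          Finset.sum_eq_single i (fun j _ hj ↦ hψj hj) (by simp), hψx₁ hk, hψi]
        simp
      · rw [AlgHom.comp_apply, paramHom_X_succ, map_add, hψx₂ (by omega) (by omega),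
          hψx₁ (Nat.mod_lt _ hk), paramVar_add]
        simp
    exact DFunLike.congr_fun this t
  · rw [hψi]
    exact X_zero_sub_paramVar_ne_zero _
  · refine h.induction_on (P := fun b ↦ y i * b = y i * paramHom K k q x y (ψ b)) b
      (fun a ha ↦ ?_) (fun j ↦ ?_) (fun r ↦ ?_) (fun b c hb hc ↦ ?_) (fun b c hb hc ↦ ?_)
    · rcases lt_or_ge a k with hak | hak
      · rw [hψx₁ hak, hyw hak]
      · rw [hψx₂ hak ha, map_sub, mul_sub, hyw (Nat.mod_lt _ hk), paramHom_paramVar hak ha]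
        ring
    · by_cases hj : j = i
      · subst hj
        rw [hψi, map_sub, mul_sub, hyw hk, paramHom_X_zero, mul_add, Finset.mul_sum,
          hsum _ fun l hl ↦ h.y_mul_y j l hl.symm]
        ring
      · rw [hψj hj, map_zero, mul_zero, h.y_mul_y i j (Ne.symm hj)]
    · rw [AlgHom.commutes, AlgHom.commutes]
    · rw [map_add, map_add, mul_add, mul_add, hb, hc]
    · rw [map_mul, map_mul, ← mul_assoc, hb, mul_right_comm, hc]
      ring
  · rcases lt_or_ge a k with hak | hak
    · rw [hψx₁ hak, hw0]
    · rw [hψx₂ hak ha, map_sub, hw0, constantCoeff_paramVar, sub_zero]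
  · by_cases hj : j = i
    · rw [hj, hψi, map_sub, hw0, constantCoeff_X, sub_zero]
    · rw [hψj hj, map_zero]

theorem exists_baseHom (hk : 0 < k) :
    ∃ (β : B →ₐ[K] MvPolynomial (Fin (k - 1)) (MvPolynomial (Fin (q + 1)) K))
      (σ : MvPolynomial (Fin (k - 1)) (MvPolynomial (Fin (q + 1)) K) →+* B),
      (∀ t, σ (C t) = paramHom K k q x y t) ∧ (∀ t, β (paramHom K k q x y t) = C t) ∧
      (∀ s, β (σ s) = s) ∧ (∀ i, β (y i) = 0) ∧
      ∀ b, b - σ (β b) ∈ Ideal.span (Set.range y) := by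
  let S := MvPolynomial (Fin (k - 1)) (MvPolynomial (Fin (q + 1)) K)
  let u : ℕ → S := fun c ↦ if hc : 0 < c ∧ c < k then X ⟨c - 1, by omega⟩ else C (X 0)
  have hu0 : u 0 = C (X 0) := by simp [u]
  have hu (c : Fin (k - 1)) : u (c + 1) = X c := by
    have : 0 < c.val + 1 ∧ c.val + 1 < k := by omega
    simp [u, dif_pos this]
  obtain ⟨β, hβx, hβy⟩ := h.exists_lift S
    (fun a ↦ if a < k then u a else C (paramVar K k q a) - u (a % k)) (fun _ ↦ 0)
    (by simp) (by simp)
  have hβx₁ {a : ℕ} (ha : a < k) : β (x a) = u a := by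
    rw [hβx a (by omega), if_pos ha]
  have hβx₂ {a : ℕ} (ha : k ≤ a) (ha' : a < k + q) :
      β (x a) = C (paramVar K k q a) - u (a % k) := by
    rw [hβx a ha', if_neg (by omega)]
  let σ : S →+* B := eval₂Hom (paramHom K k q x y).toRingHom fun c ↦ x (c + 1)
  have hσC (t) : σ (C t) = paramHom K k q x y t := eval₂_C _ _ _
  have hσX (c) : σ (X c) = x (c + 1) := eval₂_X _ _ _
  have hβφ (t) : β (paramHom K k q x y t) = C t := by
    have : (β.comp (paramHom K k q x y)) =
        (Algebra.ofId (MvPolynomial (Fin (q + 1)) K) S).restrictScalars K := by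
      refine MvPolynomial.algHom_ext fun s ↦ ?_
      refine Fin.cases ?_ (fun s ↦ ?_) s
      · rw [AlgHom.comp_apply, paramHom_X_zero, map_add, map_sum,
          Finset.sum_eq_zero (fun j _ ↦ hβy j), hβx₁ hk, hu0, add_zero]
        rfl
      · rw [AlgHom.comp_apply, paramHom_X_succ, map_add, hβx₂ (by omega) (by omega),
          hβx₁ (Nat.mod_lt _ hk), paramVar_add, sub_add_cancel]
        rfl
    exact DFunLike.congr_fun this t
  have hσu {c : ℕ} (hc : c < k) : x c - σ (u c) ∈ Ideal.span (Set.range y) := by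
    rcases Nat.eq_zero_or_pos c with rfl | hc0
    · rw [hu0, hσC, paramHom_X_zero, sub_add_cancel_left]
      exact neg_mem (sum_mem fun i _ ↦ Ideal.subset_span ⟨i, rfl⟩)
    · obtain ⟨c, rfl⟩ := Nat.exists_eq_add_of_le' hc0
      rw [hu ⟨c, by omega⟩, hσX, sub_self]
      exact zero_mem _
  refine ⟨β, σ, hσC, hβφ, fun s ↦ ?_, hβy, fun b ↦ ?_⟩
  · have : (β : B →+* S).comp σ = RingHom.id S := by
      refine MvPolynomial.ringHom_ext (fun t ↦ ?_) fun c ↦ ?_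
      · simp only [RingHom.comp_apply, hσC, RingHom.coe_coe, hβφ]
        rfl
      · simp only [RingHom.comp_apply, hσX, RingHom.coe_coe]
        rw [hβx₁ (by omega), hu]
        rfl
    exact DFunLike.congr_fun this s
  · refine h.induction_on (P := fun b ↦ b - σ (β b) ∈ Ideal.span (Set.range y)) b
      (fun a ha ↦ ?_) (fun j ↦ ?_) (fun r ↦ ?_) (fun b c hb hc ↦ ?_) (fun b c hb hc ↦ ?_)
    · rcases lt_or_ge a k with hak | hak
      · rw [hβx₁ hak]
        exact hσu hak
      · rw [hβx₂ hak ha, map_sub, hσC, paramHom_paramVar hak ha]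
        convert neg_mem (hσu (Nat.mod_lt a hk)) using 1
        ring
    · rw [hβy, map_zero, sub_zero]
      exact Ideal.subset_span ⟨j, rfl⟩
    · have : algebraMap K S r = C (C r) := rfl
      rw [AlgHom.commutes, this, hσC, ← algebraMap_eq, AlgHom.commutes, sub_self]
      exact zero_mem _
    · rw [map_add, map_add, add_sub_add_comm]
      exact add_mem hb hc
    · have : b * c - σ (β (b * c)) = b * (c - σ (β c)) + σ (β c) * (b - σ (β b)) := by
        rw [map_mul, map_mul]; ring
      rw [this]
      exact add_mem (Ideal.mul_mem_left _ _ hc) (Ideal.mul_mem_left _ _ hb)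

theorem ringKrullDim_eq (hk : 0 < k) : ringKrullDim B = ((k + q : ℕ) : WithBot ℕ∞) := by
  obtain ⟨β, σ, hσC, hβφ, hβσ, hβy, hJ⟩ := h.exists_baseHom hk
  choose ψ hψφ hψj hψi hyψ hψx hψy using h.exists_transversalHom hk
  have hS : ringKrullDim (MvPolynomial (Fin (k - 1)) (MvPolynomial (Fin (q + 1)) K)) =
      ((k + q : ℕ) : WithBot ℕ∞) := by
    rw [ringKrullDim_of_isNoetherianRing, ringKrullDim_of_isNoetherianRing,
      ringKrullDim_eq_zero_of_field, zero_add, Nat.card_fin, Nat.card_fin, ← Nat.cast_add]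
    congr 1
    omega
  have hT : ringKrullDim (MvPolynomial (Fin (q + 1)) K) ≤ ((k + q : ℕ) : WithBot ℕ∞) := by
    rw [ringKrullDim_of_isNoetherianRing, ringKrullDim_eq_zero_of_field, zero_add, Nat.card_fin]
    exact_mod_cast (by omega : q + 1 ≤ k + q)
  have hβ : Function.Surjective β := fun s ↦ ⟨σ s, hβσ s⟩
  apply le_antisymm
  · rw [ringKrullDim, Order.krullDim_eq_iSup_coheight]
    refine iSup_le fun P ↦ ?_
    rcases ker_le_or_exists_ker_le (φ := (paramHom K k q x y).toRingHom)
      (ψ := fun i ↦ (ψ i).toRingHom) (β := β.toRingHom) hJ hyψ P.asIdeal with hP | ⟨i, hP⟩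
    · exact (coheight_le_ringKrullDim_of_ker_le β.toRingHom hβ P hP).trans hS.le
    · exact (coheight_le_ringKrullDim_of_ker_le (ψ i).toRingHom
        (fun t ↦ ⟨_, hψφ i t⟩) P hP).trans hT
  · rw [← hS]
    exact ringKrullDim_le_of_surjective β.toRingHom hβ

theorem isWeaklyRegular_paramHom (hk : 0 < k) :
    RingTheory.Sequence.IsWeaklyRegular B
      ((List.ofFn (X : Fin (q + 1) → MvPolynomial (Fin (q + 1)) K)).map (paramHom K k q x y)) := by
  obtain ⟨β, σ, hσC, hβφ, hβσ, hβy, hJ⟩ := h.exists_baseHom hk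
  choose ψ hψφ hψj hψi hyψ hψx hψy using h.exists_transversalHom hk
  let := (paramHom K k q x y).toRingHom.toAlgebra
  let β' : B →ₐ[MvPolynomial (Fin (q + 1)) K] _ := { β.toRingHom with commutes' := hβφ }
  let σ' : _ →ₐ[MvPolynomial (Fin (q + 1)) K] B := { σ with commutes' := hσC }
  let ψ' (i : Fin m) : B →ₐ[MvPolynomial (Fin (q + 1)) K] MvPolynomial (Fin (q + 1)) K :=
    { (ψ i).toRingHom with commutes' := hψφ i }
  have : Module.Flat (MvPolynomial (Fin (q + 1)) K) B :=
    flat_of_section (ψ := ψ') (β := β') (σ := σ') hβσ hβy hJ hψj hψi hyψ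
  exact (isWeaklyRegular_ofFn_X K (q + 1)).of_flat

theorem isGreatest_length_isRegular [IsNoetherianRing B] (hk : 0 < k) (hm : 0 < m) :
    IsGreatest {l | ∃ rs : List B, rs.length = l ∧
      (∀ r ∈ rs, r ∈ Ideal.span (x '' Set.Iio (k + q) ∪ Set.range y)) ∧
      RingTheory.Sequence.IsRegular B rs} (q + 1) := by
  obtain ⟨ψ, hψφ, hψj, hψi, hyψ, hψx, hψy⟩ := h.exists_transversalHom hk ⟨0, hm⟩
  let ε : B →+* K := constantCoeff.comp ψ.toRingHom
  have hε : Ideal.span (x '' Set.Iio (k + q) ∪ Set.range y) ≤ RingHom.ker ε := by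
    rw [Ideal.span_le, Set.union_subset_iff]
    constructor
    · rintro _ ⟨a, ha, rfl⟩
      exact hψx a ha
    · rintro _ ⟨j, rfl⟩
      exact hψy j
  have hxmem {a : ℕ} (ha : a < k + q) :
      x a ∈ Ideal.span (x '' Set.Iio (k + q) ∪ Set.range y) :=
    Ideal.subset_span (Or.inl ⟨a, ha, rfl⟩)
  have hymem (j : Fin m) : y j ∈ Ideal.span (x '' Set.Iio (k + q) ∪ Set.range y) :=
    Ideal.subset_span (Or.inr ⟨j, rfl⟩)
  have hprime : (RingHom.ker ε).IsPrime := RingHom.ker_isPrime ε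
  constructor
  · have hmem : ∀ r ∈ (List.ofFn X).map (paramHom K k q x y),
        r ∈ Ideal.span (x '' Set.Iio (k + q) ∪ Set.range y) := by
      simp only [List.mem_map, List.mem_ofFn]
      rintro _ ⟨_, ⟨t, rfl⟩, rfl⟩
      refine Fin.cases ?_ (fun t ↦ ?_) t
      · rw [paramHom_X_zero]
        exact add_mem (hxmem (by omega)) (sum_mem fun j _ ↦ hymem j)
      · rw [paramHom_X_succ]
        have := Nat.mod_lt (k + t) hk
        exact add_mem (hxmem (by omega)) (hxmem (by omega))
    refine ⟨(List.ofFn X).map (paramHom K k q x y), by simp, hmem,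
      h.isWeaklyRegular_paramHom hk, fun htop ↦ hprime.ne_top (top_le_iff.1 ?_)⟩
    rw [smul_eq_mul, Ideal.mul_top] at htop
    rw [htop]
    exact (Ideal.span_le.2 hmem).trans hε
  · rintro _ ⟨rs, rfl, hrs, hreg⟩
    let P : PrimeSpectrum B := ⟨RingHom.ker ψ.toRingHom, RingHom.ker_isPrime _⟩
    have h1 := length_le_coheight_of_isWeaklyRegular (𝔪 := RingHom.ker ε) rs
      (fun r hr ↦ hε (hrs r hr)) hreg.toIsWeaklyRegular P
      (fun b hb ↦ by
        change constantCoeff (ψ b) = 0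
        rw [show ψ b = 0 from hb, map_zero])
      (y ⟨0, hm⟩) (ker_eq_colon_of_mul_eq (φ := (paramHom K k q x y).toRingHom) hψi hyψ)
    have h2 := coheight_le_ringKrullDim_of_ker_le ψ.toRingHom (fun t ↦ ⟨_, hψφ t⟩) P le_rfl
    rw [ringKrullDim_of_isNoetherianRing, ringKrullDim_eq_zero_of_field, zero_add,
      Nat.card_fin] at h2
    have h3 := (WithBot.coe_le_coe.2 h1).trans h2
    exact_mod_cast h3

end IsTransversalPresentation
end

/-- The graph on a clique `Fin m` and an independent set `Fin d`, in which the clique vertex `i` is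
joined to the `i`-th transversal of the residue classes modulo `k` in `Fin d`. -/
def transversalGraph (d m k : ℕ) : SimpleGraph (Fin d ⊕ Fin m) where
  Adj
    | .inl _, .inl _ => False
    | .inl a, .inr i => residueTransversal d k i (a % k) = a
    | .inr i, .inl a => residueTransversal d k i (a % k) = a
    | .inr i, .inr j => i ≠ j
  symm := ⟨by
    rintro (a | i) (b | j) h
    exacts [h, h, h, h.symm]⟩
  loopless := ⟨by
    rintro (a | i) h
    exacts [h, h rfl]⟩

theorem transversalGraph_connected {d m k : ℕ} (hm : 0 < m) (hd : d ≤ m * k) :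
    (transversalGraph d m k).Connected := by
  rw [SimpleGraph.connected_iff_exists_forall_reachable]
  have hinr (i : Fin m) : (transversalGraph d m k).Reachable (.inr ⟨0, hm⟩) (.inr i) := by
    by_cases hi : ⟨0, hm⟩ = i
    · rw [hi]
    · exact SimpleGraph.Adj.reachable hi
  refine ⟨.inr ⟨0, hm⟩, ?_⟩
  rintro (a | i)
  · have hlt : a.val / k < m := Nat.div_lt_of_lt_mul (by rw [mul_comm]; omega)
    refine (hinr ⟨a / k, hlt⟩).trans (SimpleGraph.Adj.reachable ?_)
    change residueTransversal d k (a / k) (a % k) = a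
    have : a.val / k * k + a.val % k = a := Nat.div_add_mod' _ _
    rw [residueTransversal, this, if_pos a.2]
  · exact hinr i

theorem exists_algHom_quotient_edgeIdeal {K V S : Type*} [Field K] [CommRing S] [Algebra K S]
    {G : SimpleGraph V} (v : V → S) (hv : ∀ u w, G.Adj u w → v u * v w = 0) :
    ∃ f : (MvPolynomial V K ⧸ edgeIdeal K G) →ₐ[K] S,
      ∀ u, f (Ideal.Quotient.mk (edgeIdeal K G) (X u)) = v u := by
  have h : ∀ a ∈ edgeIdeal K G, aeval v a = 0 := by
    change edgeIdeal K G ≤ RingHom.ker (aeval v : MvPolynomial V K →ₐ[K] S)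
    rw [edgeIdeal, Ideal.span_le]
    rintro _ ⟨u, w, huw, rfl⟩
    simp [RingHom.mem_ker, hv u w huw]
  exact ⟨Ideal.Quotient.liftₐ _ (aeval v) h, fun u ↦ aeval_X v u⟩

theorem adjoin_range_mk_X_eq_top {K V : Type*} [Field K] (I : Ideal (MvPolynomial V K)) :
    Algebra.adjoin K (Set.range fun v ↦ Ideal.Quotient.mk I (X v)) = ⊤ := by
  have h : (Set.range fun v ↦ Ideal.Quotient.mk I (X v)) =
      Ideal.Quotient.mkₐ K I '' Set.range X := by
    rw [← Set.range_comp]; rfl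
  rw [h, ← AlgHom.map_adjoin, adjoin_range_X, Algebra.map_top, AlgHom.range_eq_top]
  exact Ideal.Quotient.mkₐ_surjective K I

section
variable {K : Type u} [Field K] {V : Type} {d m k : ℕ} (e : V ≃ Fin d ⊕ Fin m)

/-- The classes of the variables of the independent vertices in the edge ring. -/
noncomputable def independentClass (G : SimpleGraph V) (a : ℕ) :
    MvPolynomial V K ⧸ edgeIdeal K G :=
  if h : a < d then Ideal.Quotient.mk _ (X (e.symm (.inl ⟨a, h⟩))) else 0

/-- The classes of the variables of the clique vertices in the edge ring. -/
noncomputable def cliqueClass (G : SimpleGraph V) (i : Fin m) :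
    MvPolynomial V K ⧸ edgeIdeal K G :=
  Ideal.Quotient.mk _ (X (e.symm (.inr i)))

theorem range_mk_X_eq (G : SimpleGraph V) :
    (Set.range fun v ↦ Ideal.Quotient.mk (edgeIdeal K G) (X v)) =
      independentClass e G '' Set.Iio d ∪ Set.range (cliqueClass e G) := by
  ext b
  constructor
  · rintro ⟨v, rfl⟩
    obtain ⟨s, rfl⟩ := e.symm.surjective v
    rcases s with a | i
    · exact Or.inl ⟨a, a.2, by simp [independentClass]⟩
    · exact Or.inr ⟨i, rfl⟩
  · rintro (⟨a, ha, rfl⟩ | ⟨i, rfl⟩)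
    · refine ⟨e.symm (.inl ⟨a, ha⟩), ?_⟩
      rw [independentClass, dif_pos (Set.mem_Iio.1 ha)]
    · exact ⟨_, rfl⟩

theorem isTransversalPresentation_edgeRing :
    IsTransversalPresentation K d k
      (independentClass (K := K) e ((transversalGraph d m k).comap e))
      (cliqueClass e ((transversalGraph d m k).comap e)) where
  y_mul_y i j hij := by
    rw [cliqueClass, cliqueClass, ← map_mul, Ideal.Quotient.eq_zero_iff_mem]
    exact Ideal.subset_span ⟨_, _, by simpa [transversalGraph] using hij, rfl⟩
  y_mul_x i a ha h := by
    rw [cliqueClass, independentClass, dif_pos ha, ← map_mul, Ideal.Quotient.eq_zero_iff_mem]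
    exact Ideal.subset_span ⟨_, _, by simpa [transversalGraph] using h, rfl⟩
  adjoin_eq_top := by
    rw [← range_mk_X_eq, adjoin_range_mk_X_eq_top]
  exists_lift S _ _ x' y' hyy hyx := by
    obtain ⟨f, hf⟩ := exists_algHom_quotient_edgeIdeal (K := K)
      (G := (transversalGraph d m k).comap e)
      (fun v ↦ Sum.elim (fun a : Fin d ↦ x' a) y' (e v)) (fun u w huw ↦ by
        rw [SimpleGraph.comap_adj] at huw
        generalize e u = u', e w = w' at huw
        rcases u' with a | i <;> rcases w' with b | j
        · exact huw.elim
        · rw [mul_comm]; exact hyx j a a.2 huw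
        · exact hyx i b b.2 huw
        · exact hyy i j huw)
    refine ⟨f, fun a ha ↦ ?_, fun i ↦ ?_⟩
    · rw [independentClass, dif_pos ha, hf]; simp
    · rw [cliqueClass, hf]; simp
end

/-- Theorem 1.2 (Hibi–Kanno–Matsuda–Van Tuyl): for `n ≥ 2` and natural numbers `d, p`
with `1 ≤ p ≤ d ≤ n - 1` and `d ≤ (n - d)(d - p + 1)`, there exists a finite simple
connected graph `G` on `n` vertices with `dim R/I(G) = d` and `depth R/I(G) = p`. -/
theorem exists_graph_dim_depth (K : Type*) [Field K] (n d p : ℕ) (hn : 2 ≤ n)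
    (hp : 1 ≤ p) (hpd : p ≤ d) (hd : d ≤ n - 1) (hineq : d ≤ (n - d) * (d - p + 1)) :
    ∃ G : SimpleGraph (Fin n), G.Connected ∧
      ringKrullDim (MvPolynomial (Fin n) K ⧸ edgeIdeal K G) = (d : WithBot (WithTop ℕ)) ∧
      edgeRingDepth K G = p := by
  obtain ⟨q, rfl⟩ := Nat.exists_eq_add_of_le' hp
  obtain ⟨k, hk⟩ : ∃ k, k = d - (q + 1) + 1 := ⟨_, rfl⟩
  rw [← hk] at hineq
  obtain rfl : d = k + q := by omega
  have hk0 : 0 < k := by omega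
  have hm : 0 < n - (k + q) := by omega
  let e : Fin n ≃ Fin (k + q) ⊕ Fin (n - (k + q)) :=
    (finCongr (by omega)).trans finSumFinEquiv.symm
  have h := isTransversalPresentation_edgeRing (K := K) (k := k) e
  refine ⟨(transversalGraph (k + q) (n - (k + q)) k).comap e, ?_, h.ringKrullDim_eq hk0, ?_⟩
  · exact (SimpleGraph.Iso.comap e _).connected_iff.2 (transversalGraph_connected hm hineq)
  · rw [edgeRingDepth, range_mk_X_eq e]
    exact (h.isGreatest_length_isRegular hk0 hm).csSup_eq
end

section
/- Let K be a field and n ≥ 3 an integer. For natural numbers d and p, the following are equivalent: (1) there exists a finite simple connected graph G on n vertices such that the Krull dimension of R/I(G) equals d and the depth of R/I(G) equals p, where I(G) ⊆ R = K[x_1, …, x_n] is the edge ideal of G; (2) 1 ≤ p ≤ d ≤ n − 1 and d ≤ (n − d)(d − p + 1). -/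
open MvPolynomial

set_option synthInstance.maxHeartbeats 1000000

/-- If `x ∈ m` is regular on `M`, every associated prime of `M` contained in the prime `m` lies
strictly below an associated prime of `M / xM` contained in `m`. -/
theorem exists_gt_mem_associatedPrimes_quotSMulTop {R M : Type*} [CommRing R] [IsNoetherianRing R]
    [AddCommGroup M] [Module R M] [Module.Finite R M] {m P : Ideal R} [m.IsPrime]
    (hP : P ∈ associatedPrimes R M) (hPm : P ≤ m) {x : R} (hx : x ∈ m) (hreg : IsSMulRegular M x) :
    ∃ Q ∈ associatedPrimes R (QuotSMulTop x M), P < Q ∧ Q ≤ m := by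
  obtain ⟨hPprime, u, hu⟩ := isAssociatedPrime_iff.mp hP
  have mem_P {a : R} : a ∈ P ↔ a • u = 0 := by rw [hu]; simp [Submodule.mem_colon_singleton]
  have hu0 : u ≠ 0 := fun h =>
    hPprime.ne_top ((Ideal.eq_top_iff_one P).mpr (mem_P.mpr (by simp [h])))
  have hxP : x ∉ P := fun h => hu0 (hreg.right_eq_zero_of_smul (mem_P.mp h))
  let N : Submodule R M :=
    { carrier := {v | ∀ a ∈ P, a • v = 0}
      add_mem' := fun hv hw a ha => by rw [smul_add, hv a ha, hw a ha, add_zero]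
      zero_mem' := fun a _ => smul_zero a
      smul_mem' := fun c v hv a ha => by rw [smul_comm, hv a ha, smul_zero] }
  have huN : u ∈ N := fun a ha => mem_P.mp ha
  let N' : Submodule R (QuotSMulTop x M) := N.map (Submodule.mkQ _)
  have hann : Module.annihilator R N' ≤ m := by
    intro a ha
    rw [Submodule.mem_annihilator] at ha
    have key : ∀ v : N, ∃ w ∈ N, x • w = a • (v : M) := by
      intro v
      have h0 := ha _ (Submodule.mem_map_of_mem v.2)
      rw [← map_smul, Submodule.mkQ_apply, Submodule.Quotient.mk_eq_zero,
        Submodule.mem_smul_pointwise_iff_exists] at h0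
      obtain ⟨w, -, hw⟩ := h0
      refine ⟨w, fun b hb => hreg.right_eq_zero_of_smul ?_, hw⟩
      rw [smul_comm, hw, smul_comm, v.2 b hb, smul_zero]
    obtain ⟨p, hmonic, -, hcoeff, hp⟩ :=
      LinearMap.exists_monic_and_natDegree_eq_and_coeff_mem_pow_and_aeval_eq_zero R
        (algebraMap R (Module.End R N) a) m (by
          rintro _ ⟨v, rfl⟩
          obtain ⟨w, hwN, hw⟩ := key v
          have : (algebraMap R (Module.End R N) a) v = x • (⟨w, hwN⟩ : N) := by
            ext; simp [hw]
          rw [this]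
          exact Submodule.smul_mem_smul hx trivial)
    have hev : p.eval a ∈ m := by
      apply hPm
      rw [mem_P]
      have := congrArg (fun f : Module.End R N => ((f ⟨u, huN⟩ : N) : M)) hp
      simpa [Polynomial.aeval_algebraMap_apply] using this
    have hpow : a ^ p.natDegree ∈ m := by
      rw [Polynomial.eval_eq_sum_range, Finset.sum_range_succ, hmonic.coeff_natDegree, one_mul]
        at hev
      refine (Ideal.add_mem_iff_right _ (Ideal.sum_mem _ fun i hi => ?_)).mp hev
      exact Ideal.mul_mem_right _ _ (Ideal.pow_le_self (by
        have := Finset.mem_range.mp hi; omega) (hcoeff i))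
    exact Ideal.IsPrime.mem_of_pow_mem ‹_› _ hpow
  obtain ⟨Q, hQ, hQm⟩ := Ideal.exists_minimalPrimes_le hann
  have hQass := Module.associatedPrimes.minimalPrimes_annihilator_subset_associatedPrimes R N' hQ
  refine ⟨Q, associatedPrimes.subset_of_injective N'.injective_subtype hQass, ?_, hQm⟩
  have hle : ∀ a, a ∈ P ∨ a = x → a ∈ Q := by
    intro a ha
    apply hQ.1.2
    rw [Submodule.mem_annihilator]
    rintro _ ⟨v, hv, rfl⟩
    rw [← map_smul]
    rcases ha with ha | rfl
    · rw [hv a ha, map_zero]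
    · rw [Submodule.mkQ_apply, Submodule.Quotient.mk_eq_zero]
      exact Submodule.smul_mem_pointwise_smul _ _ _ trivial
  exact lt_of_le_of_ne (fun a ha => hle a (Or.inl ha)) fun h => hxP (h ▸ hle x (Or.inr rfl))

/-- The length of a weakly regular sequence in a prime `m` is at most the coheight of any
associated prime contained in `m`. -/
theorem length_le_coheight_of_isWeaklyRegular_s10 {R M : Type*} [CommRing R] [IsNoetherianRing R]
    [AddCommGroup M] [Module R M] [Module.Finite R M] {m P : Ideal R} [m.IsPrime] [hP' : P.IsPrime]
    (hP : P ∈ associatedPrimes R M) (hPm : P ≤ m) {rs : List R} (hrs : ∀ r ∈ rs, r ∈ m)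
    (hreg : RingTheory.Sequence.IsWeaklyRegular M rs) :
    (rs.length : ℕ∞) ≤ Order.coheight (⟨P, hP'⟩ : PrimeSpectrum R) := by
  induction rs generalizing M P with
  | nil => simp
  | cons x rs ih =>
    rw [RingTheory.Sequence.isWeaklyRegular_cons_iff] at hreg
    obtain ⟨Q, hQ, hPQ, hQm⟩ :=
      exists_gt_mem_associatedPrimes_quotSMulTop hP hPm (hrs x (by simp)) hreg.1
    have := hQ.isPrime
    have h1 := ih hQ hQm (fun r hr => hrs r (by simp [hr])) hreg.2
    rw [List.length_cons, Nat.cast_add, Nat.cast_one]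
    refine (add_le_add_left h1 1).trans ?_
    exact Order.coheight_add_one_le (show (⟨P, hP'⟩ : PrimeSpectrum R) < ⟨Q, this⟩ from hPQ)

section VariableIdeals

variable {K : Type*} [Field K] {V : Type*}

theorem mem_span_X_image_iff_killCompl_eq_zero (s : Set V) (f : MvPolynomial V K) :
    f ∈ Ideal.span (X '' s : Set (MvPolynomial V K)) ↔
      killCompl (Subtype.val_injective : Function.Injective ((↑) : ↥sᶜ → V)) f = 0 := by
  classical
  rw [mem_ideal_span_X_image]
  constructor
  · intro h
    ext m
    rw [coeff_killCompl, coeff_zero]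
    by_contra hm
    obtain ⟨i, hi, hne⟩ := h _ (mem_support_iff.mpr hm)
    exact hne (Finsupp.mapDomain_of_notMem_range _ _ (by simpa using hi))
  · intro h m hm
    by_contra! hcon
    refine mem_support_iff.mp hm ?_
    have h0 := congrArg (coeff (m.comapDomain ((↑) : ↥sᶜ → V) Subtype.val_injective.injOn)) h
    rw [coeff_killCompl, coeff_zero, Finsupp.mapDomain_comapDomain _ Subtype.val_injective] at h0
    · exact h0
    · intro i hi
      by_contra hi'
      exact Finsupp.mem_support_iff.mp hi (hcon i (by simpa using hi'))

theorem ker_killCompl_compl (s : Set V) :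
    RingHom.ker (killCompl (R := K)
      (Subtype.val_injective : Function.Injective ((↑) : ↥sᶜ → V))).toRingHom =
      Ideal.span (X '' s) := by
  ext f
  exact (mem_span_X_image_iff_killCompl_eq_zero s f).symm

instance isPrime_span_X_image (s : Set V) :
    (Ideal.span (X '' s : Set (MvPolynomial V K))).IsPrime := by
  rw [← ker_killCompl_compl]
  exact RingHom.ker_isPrime _

theorem X_mem_span_X_image_iff {s : Set V} {v : V} :
    (X v : MvPolynomial V K) ∈ Ideal.span (X '' s : Set (MvPolynomial V K)) ↔ v ∈ s := by
  refine ⟨fun h => ?_, fun h => Ideal.subset_span ⟨v, h, rfl⟩⟩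
  obtain ⟨i, hi, hne⟩ := mem_ideal_span_X_image.mp h (Finsupp.single v 1) (by simp)
  obtain rfl : v = i := by
    by_contra h
    exact hne (Finsupp.single_eq_of_ne (Ne.symm h))
  exact hi

theorem ringKrullDim_quotient_span_X_image [Finite V] (s : Set V) :
    ringKrullDim (MvPolynomial V K ⧸ Ideal.span (X '' s : Set (MvPolynomial V K))) =
      ((sᶜ.ncard : ℕ) : WithBot ℕ∞) := by
  have hsurj : Function.Surjective (killCompl (R := K)
      (Subtype.val_injective : Function.Injective ((↑) : ↥sᶜ → V))).toRingHom :=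
    fun p => ⟨rename _ p, killCompl_rename_app _ p⟩
  rw [← ker_killCompl_compl,
    ringKrullDim_eq_of_ringEquiv (RingHom.quotientKerEquivOfSurjective hsurj),
    MvPolynomial.ringKrullDim_of_isNoetherianRing, ringKrullDim_eq_zero_of_field, zero_add]
  rfl

theorem coheight_span_X_image [Finite V] (s : Set V) :
    Order.coheight (⟨Ideal.span (X '' s), isPrime_span_X_image s⟩ :
      PrimeSpectrum (MvPolynomial V K)) = sᶜ.ncard := by
  have h := ringKrullDim_quotient_span_X_image (K := K) s
  rw [ringKrullDim_quotient] at h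
  rw [← WithBot.coe_inj, Order.coheight_eq_krullDim_Ici]
  exact h

end VariableIdeals

section EdgeIdeals

variable {K : Type*} [Field K] {V : Type*} {G : SimpleGraph V}

theorem mem_edgeIdeal_iff {f : MvPolynomial V K} :
    f ∈ edgeIdeal K G ↔ ∀ m ∈ f.support, ∃ u w, G.Adj u w ∧ m u ≠ 0 ∧ m w ≠ 0 := by
  classical
  have hset : {m : MvPolynomial V K | ∃ u w, G.Adj u w ∧ m = X u * X w} =
      (fun s => monomial s (1 : K)) ''
        {s | ∃ u w, G.Adj u w ∧ s = Finsupp.single u 1 + Finsupp.single w 1} := by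
    ext m
    constructor
    · rintro ⟨u, w, h, rfl⟩
      exact ⟨_, ⟨u, w, h, rfl⟩, by simp [X, monomial_mul]⟩
    · rintro ⟨_, ⟨u, w, h, rfl⟩, rfl⟩
      exact ⟨u, w, h, by simp [X, monomial_mul]⟩
  rw [edgeIdeal, hset, mem_ideal_span_monomial_image]
  refine forall₂_congr fun m _ => ⟨?_, ?_⟩
  · rintro ⟨_, ⟨u, w, h, rfl⟩, hle⟩
    refine ⟨u, w, h, ?_, ?_⟩
    · have := hle u
      simp at this
      omega
    · have := hle w
      simp at this
      omega
  · rintro ⟨u, w, h, hu, hw⟩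
    refine ⟨_, ⟨u, w, h, rfl⟩, fun i => ?_⟩
    have hne := h.ne
    simp only [Finsupp.add_apply, Finsupp.single_apply]
    split_ifs with h1 h2 h2
    · exact absurd (h1.trans h2.symm) hne
    · subst h1; omega
    · subst h2; omega
    · simp

theorem X_mul_X_mem_edgeIdeal {u w : V} (h : G.Adj u w) :
    (X u * X w : MvPolynomial V K) ∈ edgeIdeal K G :=
  Ideal.subset_span ⟨u, w, h, rfl⟩

theorem edgeIdeal_le_iff {J : Ideal (MvPolynomial V K)} :
    edgeIdeal K G ≤ J ↔ ∀ u w, G.Adj u w → X u * X w ∈ J := by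
  rw [edgeIdeal, Ideal.span_le]
  exact ⟨fun h u w ha => h ⟨u, w, ha, rfl⟩, by rintro h _ ⟨u, w, ha, rfl⟩; exact h u w ha⟩

theorem edgeIdeal_le_span_X_image_compl {T : Set V} (hT : G.IsIndepSet T) :
    edgeIdeal K G ≤ Ideal.span (X '' Tᶜ) := by
  rw [edgeIdeal_le_iff]
  intro u w h
  by_cases hu : u ∈ T
  · exact Ideal.mul_mem_left _ _ (X_mem_span_X_image_iff.mpr fun hw => hT hu hw h.ne h)
  · exact Ideal.mul_mem_right _ _ (X_mem_span_X_image_iff.mpr hu)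

theorem exists_isIndepSet_span_X_image_compl_le {Q : Ideal (MvPolynomial V K)} [Q.IsPrime]
    (hQ : edgeIdeal K G ≤ Q) : ∃ T : Set V, G.IsIndepSet T ∧ Ideal.span (X '' Tᶜ) ≤ Q := by
  refine ⟨{v | X v ∉ Q}, fun u hu w hw _ h => ?_, ?_⟩
  · exact (Ideal.IsPrime.mem_or_mem ‹_› (hQ (X_mul_X_mem_edgeIdeal h))).elim hu hw
  · rw [Ideal.span_le]
    rintro _ ⟨v, hv, rfl⟩
    simpa using hv

/-- The Krull dimension of `R/I(G)` is the independence number of `G`. -/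
theorem ringKrullDim_quotient_edgeIdeal [Finite V] {S : Set V} (hS : G.IsIndepSet S)
    (hmax : ∀ T : Set V, G.IsIndepSet T → T.ncard ≤ S.ncard) :
    ringKrullDim (MvPolynomial V K ⧸ edgeIdeal K G) = ((S.ncard : ℕ) : WithBot ℕ∞) := by
  apply le_antisymm
  · rw [ringKrullDim_quotient]
    refine iSup_le fun l => ?_
    have hQ : edgeIdeal K G ≤ l.head.1.asIdeal := l.head.2
    obtain ⟨T, hT, hTQ⟩ := exists_isIndepSet_span_X_image_compl_le hQ
    have hmono : StrictMono (Subtype.val : PrimeSpectrum.zeroLocus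
      (edgeIdeal K G : Set (MvPolynomial V K)) → _) := fun _ _ h => h
    have h1 := Order.length_le_coheight (p := l.map _ hmono)
      (x := ⟨Ideal.span (X '' Tᶜ), isPrime_span_X_image _⟩) hTQ
    rw [coheight_span_X_image, compl_compl] at h1
    have h2 : l.length ≤ T.ncard := by exact_mod_cast h1
    exact_mod_cast h2.trans (hmax T hT)
  · have h := ringKrullDim_quotient_span_X_image (K := K) Sᶜ
    rw [compl_compl] at h
    rw [← h]
    exact ringKrullDim_le_of_surjective
      (Ideal.Quotient.factor (edgeIdeal_le_span_X_image_compl hS))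
      (Ideal.Quotient.factor_surjective _)

theorem span_X_image_compl_mem_associatedPrimes [Finite V] {T : Set V} (hT : G.IsIndepSet T)
    (hdom : ∀ v ∉ T, ∃ t ∈ T, G.Adj v t) :
    Ideal.span (X '' Tᶜ) ∈
      associatedPrimes (MvPolynomial V K) (MvPolynomial V K ⧸ edgeIdeal K G) := by
  classical
  have := Fintype.ofFinite V
  rw [AssociatedPrimes.mem_iff, isAssociatedPrime_iff]
  refine ⟨isPrime_span_X_image _, Ideal.Quotient.mk _ (∏ t ∈ T.toFinset, X t), ?_⟩
  ext f
  have hmem : f ∈ (⊥ : Submodule (MvPolynomial V K) (MvPolynomial V K ⧸ edgeIdeal K G)).colon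
      {Ideal.Quotient.mk _ (∏ t ∈ T.toFinset, X t)} ↔
      f * ∏ t ∈ T.toFinset, X t ∈ edgeIdeal K G := by
    rw [Submodule.mem_colon_singleton, Submodule.mem_bot, ← Ideal.Quotient.eq_zero_iff_mem]
    rfl
  rw [hmem]
  constructor
  · suffices h : Ideal.span (X '' Tᶜ) ≤ Submodule.comap
      (LinearMap.mulRight (MvPolynomial V K) (∏ t ∈ T.toFinset, X t)) (edgeIdeal K G) from
      fun hf => h hf
    rw [Ideal.span_le]
    rintro _ ⟨v, hv, rfl⟩
    obtain ⟨t, ht, hadj⟩ := hdom v hv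
    change X v * ∏ t ∈ T.toFinset, X t ∈ edgeIdeal K G
    rw [← Finset.mul_prod_erase _ _ (Set.mem_toFinset.mpr ht), ← mul_assoc]
    exact Ideal.mul_mem_right _ _ (X_mul_X_mem_edgeIdeal hadj)
  · intro hf
    refine ((isPrime_span_X_image _).mem_or_mem (edgeIdeal_le_span_X_image_compl hT
      hf)).resolve_right
      fun h => ?_
    rw [Ideal.IsPrime.prod_mem_iff] at h
    obtain ⟨t, ht, h⟩ := h
    exact X_mem_span_X_image_iff.mp h (Set.mem_toFinset.mp ht)

theorem length_le_ncard_of_isRegular [Finite V] {T : Set V} (hT : G.IsIndepSet T)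
    (hdom : ∀ v ∉ T, ∃ t ∈ T, G.Adj v t) {rs : List (MvPolynomial V K ⧸ edgeIdeal K G)}
    (hrs : ∀ r ∈ rs, r ∈ Ideal.span
      (Set.range fun w => Ideal.Quotient.mk (edgeIdeal K G) (X w)))
    (hreg : RingTheory.Sequence.IsRegular (MvPolynomial V K ⧸ edgeIdeal K G) rs) :
    rs.length ≤ T.ncard := by
  obtain ⟨rs, rfl⟩ := List.map_surjective_iff.mpr
    (Ideal.Quotient.mk_surjective (I := edgeIdeal K G)) rs
  have hm : edgeIdeal K G ≤ Ideal.span (X '' Set.univ) :=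
    edgeIdeal_le_iff.mpr fun u w _ =>
      Ideal.mul_mem_left _ _ (X_mem_span_X_image_iff.mpr trivial)
  have hmem : ∀ r ∈ rs, r ∈ Ideal.span (X '' Set.univ : Set (MvPolynomial V K)) := by
    intro r hr
    have h := hrs _ (List.mem_map_of_mem hr)
    have hrange : Set.range (fun w => Ideal.Quotient.mk (edgeIdeal K G) (X w)) =
        Ideal.Quotient.mk (edgeIdeal K G) '' (X '' Set.univ) := by
      rw [Set.image_univ, ← Set.range_comp]; rfl
    rw [hrange, ← Ideal.map_span, Ideal.mem_quotient_iff_mem hm] at h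
    exact h
  have h := length_le_coheight_of_isWeaklyRegular_s10 (span_X_image_compl_mem_associatedPrimes hT hdom)
    (Ideal.span_mono (Set.image_mono (Set.subset_univ _))) hmem
    ((RingTheory.Sequence.isWeaklyRegular_map_algebraMap_iff
      (MvPolynomial V K ⧸ edgeIdeal K G) _ rs).mp hreg.toIsWeaklyRegular)
  rw [coheight_span_X_image, compl_compl] at h
  rw [List.length_map]
  exact_mod_cast h

end EdgeIdeals

section ExtVanishing

open CategoryTheory Abelian

universe u

/-- If `L = J : x`, then `Ext N (R ⧸ J) i` vanishes as soon as `Ext N (R ⧸ L) i` and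
`Ext N (R ⧸ (J + (x))) i` do. -/
theorem subsingleton_ext_quotient_of_colon {R : Type u} [CommRing R] (N : ModuleCat.{u} R)
    {J L : Ideal R} {x : R} (hL : ∀ a, a ∈ L ↔ a * x ∈ J) {i : ℕ}
    (h₁ : Subsingleton (Ext N (ModuleCat.of R (R ⧸ L)) i))
    (h₂ : Subsingleton (Ext N (ModuleCat.of R (R ⧸ J ⊔ Ideal.span {x})) i)) :
    Subsingleton (Ext N (ModuleCat.of R (R ⧸ J)) i) := by
  let f : (R ⧸ L) →ₗ[R] (R ⧸ J) :=
    Submodule.mapQ L J (LinearMap.mulRight R x) fun a ha => (hL a).mp ha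
  let g : (R ⧸ J) →ₗ[R] (R ⧸ J ⊔ Ideal.span {x}) := Submodule.factor le_sup_left
  have hf : Function.Injective f := by
    rw [← LinearMap.ker_eq_bot, LinearMap.ker_eq_bot']
    intro a ha
    obtain ⟨a, rfl⟩ := L.mkQ_surjective a
    change Submodule.Quotient.mk (a * x) = 0 at ha
    rw [Submodule.Quotient.mk_eq_zero] at ha
    rw [Submodule.mkQ_apply, Submodule.Quotient.mk_eq_zero]
    exact (hL a).mpr ha
  have hg : Function.Surjective g := Submodule.factor_surjective _
  have hfg : Function.Exact f g := by
    intro b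
    obtain ⟨b, rfl⟩ := J.mkQ_surjective b
    change Submodule.Quotient.mk b = 0 ↔ _
    rw [Submodule.Quotient.mk_eq_zero, Submodule.mem_sup]
    constructor
    · rintro ⟨j, hj, c, hc, rfl⟩
      obtain ⟨a, rfl⟩ := Ideal.mem_span_singleton'.mp hc
      refine ⟨L.mkQ a, ?_⟩
      change Submodule.Quotient.mk (a * x) = Submodule.Quotient.mk (j + a * x)
      rw [Submodule.Quotient.eq]
      simpa using hj
    · rintro ⟨a, ha⟩
      obtain ⟨a, rfl⟩ := L.mkQ_surjective a
      change Submodule.Quotient.mk (a * x) = Submodule.Quotient.mk b at ha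
      rw [Submodule.Quotient.eq] at ha
      exact ⟨b - a * x, by simpa using J.neg_mem ha, a * x,
        Ideal.mem_span_singleton'.mpr ⟨a, rfl⟩, by ring⟩
  let T : ShortComplex (ModuleCat.{u} R) :=
    ModuleCat.shortComplexOfCompEqZero f g hfg.linearMap_comp_eq_zero
  have hT : T.ShortExact :=
    { exact := ModuleCat.shortComplex_exact _ hfg
      mono_f := (ModuleCat.mono_iff_injective _).mpr hf
      epi_g := (ModuleCat.epi_iff_surjective _).mpr hg }
  refine subsingleton_of_forall_eq 0 fun e => ?_
  obtain ⟨e', he'⟩ := Ext.covariant_sequence_exact₂ N hT (n := i) e (h₂.elim _ _)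
  rw [← he', show e' = 0 from h₁.elim _ _, Ext.zero_comp]

theorem smul_top_quotient_lt_top {R : Type*} [CommRing R] {J m : Ideal R} (hJ : J ≤ m)
    (hm : m ≠ ⊤) : m • (⊤ : Submodule R (R ⧸ J)) < ⊤ := by
  rw [lt_top_iff_ne_top]
  intro h
  refine hm ((Ideal.eq_top_iff_one m).mpr ?_)
  have hle : m • (⊤ : Submodule R (R ⧸ J)) ≤ Submodule.map J.mkQ m := by
    rw [Submodule.smul_le]
    rintro a ha b -
    obtain ⟨b, rfl⟩ := Submodule.mkQ_surjective _ b
    rw [← map_smul]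
    exact Submodule.mem_map_of_mem (Ideal.mul_mem_right _ _ ha)
  have h1 : J.mkQ 1 ∈ m • (⊤ : Submodule R (R ⧸ J)) := by rw [h]; trivial
  obtain ⟨c, hc, hc1⟩ := hle h1
  simpa using Ideal.sub_mem _ hc (hJ ((Submodule.Quotient.eq _).mp hc1))

open RingTheory.Sequence in
/-- If `L = J : x`, then the depth of `R ⧸ J` is at least the minimum of the depths of `R ⧸ L` and
`R ⧸ (J + (x))`. -/
theorem exists_isRegular_quotient_of_colon {R : Type u} [CommRing R] [IsNoetherianRing R]
    {m J L : Ideal R} (hm : m ≠ ⊤) {x : R} (hL : ∀ a, a ∈ L ↔ a * x ∈ J) (hLm : L ≤ m)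
    (hJm : J ≤ m) (hx : x ∈ m) {p : ℕ}
    (h₁ : ∃ rs : List R, p ≤ rs.length ∧ (∀ r ∈ rs, r ∈ m) ∧ IsRegular (R ⧸ L) rs)
    (h₂ : ∃ rs : List R, p ≤ rs.length ∧ (∀ r ∈ rs, r ∈ m) ∧
      IsRegular (R ⧸ J ⊔ Ideal.span {x}) rs) :
    ∃ rs : List R, p ≤ rs.length ∧ (∀ r ∈ rs, r ∈ m) ∧ IsRegular (R ⧸ J) rs := by
  have hsupp : Module.support R (ModuleCat.of R (R ⧸ m)) = PrimeSpectrum.zeroLocus m := by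
    rw [Module.support_eq_zeroLocus]
    exact congrArg (fun I : Ideal R => PrimeSpectrum.zeroLocus (I : Set R))
      (Ideal.annihilator_quotient)
  have vanish {I : Ideal R} (hI : I ≤ m)
      (h : ∃ rs : List R, p ≤ rs.length ∧ (∀ r ∈ rs, r ∈ m) ∧ IsRegular (R ⧸ I) rs) :
      ∀ i < p, Subsingleton (Ext (ModuleCat.of R (R ⧸ m)) (ModuleCat.of R (R ⧸ I)) i) := by
    obtain ⟨rs, hp, hmem, hreg⟩ := h
    exact fun i hi => ModuleCat.subsingleton_ext_of_exists_isRegular m _ hsupp.subset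
      (ModuleCat.of R (R ⧸ I)) (smul_top_quotient_lt_top hI hm) rs hmem hreg i (hi.trans_le hp)
  have hJx : J ⊔ Ideal.span {x} ≤ m := sup_le hJm ((Ideal.span_singleton_le_iff_mem m).mpr hx)
  obtain ⟨rs, hlen, hmem, hreg⟩ := ModuleCat.exists_isRegular_of_exists_subsingleton_ext m p
    (ModuleCat.of R (R ⧸ J)) (smul_top_quotient_lt_top hJm hm) (ModuleCat.of R (R ⧸ m)) hsupp
    fun i hi => subsingleton_ext_quotient_of_colon _ hL (vanish hLm h₁ i hi) (vanish hJx h₂ i hi)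
  exact ⟨rs, hlen.ge, hmem, hreg⟩

end ExtVanishing

section VariableSequences

variable {K : Type*} [Field K] {V : Type*}

theorem ofList_map_X (l : List V) :
    Ideal.ofList (l.map (X : V → MvPolynomial V K)) = Ideal.span (X '' {v | v ∈ l}) := by
  refine congrArg Ideal.span (Set.ext fun f => ?_)
  simp

theorem isWeaklyRegular_map_X {l : List V} (hl : l.Nodup) :
    RingTheory.Sequence.IsWeaklyRegular (MvPolynomial V K)
      (l.map (X : V → MvPolynomial V K)) := by
  constructor
  intro i hi
  rw [isSMulRegular_quotient_iff_mem_of_smul_mem, ← List.map_take, ofList_map_X,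
    smul_eq_mul, Ideal.mul_top]
  intro f hf
  rw [smul_eq_mul] at hf
  refine ((isPrime_span_X_image _).mem_or_mem hf).resolve_left fun h => ?_
  rw [List.getElem_map, X_mem_span_X_image_iff, Set.mem_ofPred_eq] at h
  rw [List.length_map] at hi
  obtain ⟨j, hj, hji⟩ := List.mem_take_iff_getElem.mp h
  have := (List.Nodup.getElem_inj_iff hl).mp hji
  omega

/-- The variables outside `s` form a regular sequence on `R ⧸ (x_v : v ∈ s)`. -/
theorem exists_isRegular_quotient_span_X_image [Finite V] (s : Set V) :
    ∃ rs : List (MvPolynomial V K), rs.length = sᶜ.ncard ∧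
      (∀ r ∈ rs, r ∈ Ideal.span (Set.range X)) ∧
      RingTheory.Sequence.IsRegular
        (MvPolynomial V K ⧸ (Ideal.span (X '' s) : Ideal (MvPolynomial V K))) rs := by
  classical
  have := Fintype.ofFinite V
  have hnodup : (s.toFinset.toList ++ sᶜ.toFinset.toList).Nodup := by
    refine List.Nodup.append (Finset.nodup_toList _) (Finset.nodup_toList _) fun v hv hv' => ?_
    simp at hv hv'
    exact hv' hv
  have hreg := isWeaklyRegular_map_X (K := K) hnodup
  rw [List.map_append, RingTheory.Sequence.isWeaklyRegular_append_iff, ofList_map_X,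
    smul_eq_mul, Ideal.mul_top] at hreg
  have hs : {v | v ∈ s.toFinset.toList} = s := by ext; simp
  rw [hs] at hreg
  refine ⟨sᶜ.toFinset.toList.map X, ?_, ?_, hreg.2, ?_⟩
  · rw [List.length_map, Finset.length_toList, Set.ncard_eq_toFinset_card']
  · intro r hr
    obtain ⟨v, -, rfl⟩ := List.mem_map.mp hr
    exact Ideal.subset_span ⟨v, rfl⟩
  · intro h
    rw [ofList_map_X] at h
    have hlt := smul_top_quotient_lt_top (R := MvPolynomial V K)
      (Ideal.span_mono (Set.image_mono (Set.subset_univ s)))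
      (isPrime_span_X_image (K := K) (Set.univ : Set V)).ne_top
    refine hlt.ne (top_le_iff.mp (h.trans_le (Submodule.smul_mono_left ?_)))
    exact Ideal.span_mono (Set.image_mono (Set.subset_univ _))

end VariableSequences

section Depth

variable {K : Type*} [Field K] {V : Type*} {G : SimpleGraph V}

theorem edgeIdeal_le_span_range_X : edgeIdeal K G ≤ Ideal.span (Set.range X) :=
  edgeIdeal_le_iff.mpr fun _ w _ => Ideal.mul_mem_left _ _ (Ideal.subset_span ⟨w, rfl⟩)

theorem span_range_X_ne_top : Ideal.span (Set.range (X : V → MvPolynomial V K)) ≠ ⊤ := by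
  rw [← Set.image_univ]
  exact (isPrime_span_X_image _).ne_top

theorem exists_isIndepSet_forall_ncard_le [Finite V] (G : SimpleGraph V) :
    ∃ S : Set V, G.IsIndepSet S ∧ ∀ T : Set V, G.IsIndepSet T → T.ncard ≤ S.ncard := by
  obtain ⟨S, hS, hmax⟩ := Set.exists_max_image {T : Set V | G.IsIndepSet T} Set.ncard
    (Set.toFinite _) ⟨∅, by simp [SimpleGraph.IsIndepSet]⟩
  exact ⟨S, hS, hmax⟩

theorem SimpleGraph.IsIndepSet.insert {T : Set V} {v : V} (hT : G.IsIndepSet T)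
    (h : ∀ t ∈ T, ¬ G.Adj v t) : G.IsIndepSet (insert v T) := by
  rw [SimpleGraph.IsIndepSet, Set.pairwise_insert]
  exact ⟨hT, fun t ht _ => ⟨h t ht, fun h' => h t ht h'.symm⟩⟩

/-- Every independent set extends to an independent dominating set. -/
theorem exists_superset_isIndepSet_dominating [Finite V] {T : Set V} (hT : G.IsIndepSet T) :
    ∃ S : Set V, T ⊆ S ∧ G.IsIndepSet S ∧ ∀ v ∉ S, ∃ t ∈ S, G.Adj v t := by
  obtain ⟨S, ⟨hS, hTS⟩, hmax⟩ := Set.exists_max_image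
    {S : Set V | G.IsIndepSet S ∧ T ⊆ S} Set.ncard (Set.toFinite _) ⟨T, hT, subset_rfl⟩
  refine ⟨S, hTS, hS, fun v hv => ?_⟩
  by_contra! hcon
  have := hmax _ ⟨hS.insert hcon, hTS.trans (Set.subset_insert _ _)⟩
  rw [Set.ncard_insert_of_notMem hv] at this
  omega

theorem bddAbove_length_isRegular [Finite V] : BddAbove
    {n | ∃ rs : List (MvPolynomial V K ⧸ edgeIdeal K G),
    rs.length = n ∧
    (∀ r ∈ rs, r ∈ Ideal.span
      (Set.range fun w => Ideal.Quotient.mk (edgeIdeal K G) (X w))) ∧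
    RingTheory.Sequence.IsRegular (MvPolynomial V K ⧸ edgeIdeal K G) rs} := by
  obtain ⟨T, -, hT, hdom⟩ := exists_superset_isIndepSet_dominating
    (G := G) (T := ∅) (by simp [SimpleGraph.IsIndepSet])
  refine ⟨T.ncard, ?_⟩
  rintro n ⟨rs, rfl, hmem, hreg⟩
  exact length_le_ncard_of_isRegular hT hdom hmem hreg

/-- The depth of `R/I(G)` is at most the size of any independent dominating set. -/
theorem edgeRingDepth_le_ncard [Finite V] {T : Set V} (hT : G.IsIndepSet T)
    (hdom : ∀ v ∉ T, ∃ t ∈ T, G.Adj v t) : edgeRingDepth K G ≤ T.ncard := by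
  refine csSup_le' ?_
  rintro n ⟨rs, rfl, hmem, hreg⟩
  exact length_le_ncard_of_isRegular hT hdom hmem hreg

theorem le_edgeRingDepth [Finite V] {rs : List (MvPolynomial V K)}
    (hmem : ∀ r ∈ rs, r ∈ Ideal.span (Set.range X))
    (hreg : RingTheory.Sequence.IsWeaklyRegular (MvPolynomial V K ⧸ edgeIdeal K G) rs) :
    rs.length ≤ edgeRingDepth K G := by
  have hrange : Ideal.span (Set.range fun w => Ideal.Quotient.mk (edgeIdeal K G) (X w)) =
      (Ideal.span (Set.range X)).map (Ideal.Quotient.mk (edgeIdeal K G)) := by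
    rw [Ideal.map_span, ← Set.range_comp]
    rfl
  have hmem' : ∀ r ∈ rs.map (Ideal.Quotient.mk (edgeIdeal K G)), r ∈ Ideal.span
      (Set.range fun w => Ideal.Quotient.mk (edgeIdeal K G) (X w)) := by
    intro r hr
    obtain ⟨r', hr', rfl⟩ := List.mem_map.mp hr
    rw [hrange]
    exact Ideal.mem_map_of_mem _ (hmem r' hr')
  refine le_csSup bddAbove_length_isRegular ⟨rs.map (Ideal.Quotient.mk _), List.length_map _, hmem',
    ⟨(RingTheory.Sequence.isWeaklyRegular_map_algebraMap_iff
      (MvPolynomial V K ⧸ edgeIdeal K G) _ rs).mpr hreg, fun h => ?_⟩⟩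
  rw [smul_eq_mul, Ideal.mul_top] at h
  have htop : Ideal.span (Set.range fun w => Ideal.Quotient.mk (edgeIdeal K G) (X w)) = ⊤ :=
    top_le_iff.mp (h.trans_le (Ideal.span_le.mpr hmem'))
  rw [hrange, Ideal.eq_top_iff_one, ← map_one (Ideal.Quotient.mk (edgeIdeal K G)),
    Ideal.mem_quotient_iff_mem edgeIdeal_le_span_range_X, ← Ideal.eq_top_iff_one] at htop
  exact span_range_X_ne_top htop

theorem one_le_edgeRingDepth [Finite V] [Nonempty V] : 1 ≤ edgeRingDepth K G := by
  classical
  have := Fintype.ofFinite V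
  refine le_edgeRingDepth (rs := [∑ v, X v]) ?_ ?_
  · simp only [List.mem_singleton, forall_eq]
    exact Ideal.sum_mem _ fun v _ => Ideal.subset_span ⟨v, rfl⟩
  rw [RingTheory.Sequence.isWeaklyRegular_singleton_iff, isSMulRegular_quotient_iff_mem_of_smul_mem]
  intro f hf
  by_contra hfI
  rw [mem_edgeIdeal_iff] at hfI
  push Not at hfI
  obtain ⟨m, hm, hind⟩ := hfI
  obtain ⟨T, hT, hTne, hmT⟩ : ∃ T : Set V, G.IsIndepSet T ∧ T.Nonempty ∧ ↑m.support ⊆ T := by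
    rcases m.support.eq_empty_or_nonempty with h | h
    · obtain ⟨v⟩ := ‹Nonempty V›
      exact ⟨{v}, by simp [SimpleGraph.IsIndepSet], by simp, by simp [h]⟩
    · refine ⟨m.support, fun u hu w hw _ h => ?_, h, subset_rfl⟩
      exact Finsupp.mem_support_iff.mp hw (hind u w h (Finsupp.mem_support_iff.mp hu))
  rcases (isPrime_span_X_image _).mem_or_mem (edgeIdeal_le_span_X_image_compl hT hf) with h | h
  · obtain ⟨t, ht⟩ := hTne
    obtain ⟨i, hi, hne⟩ := mem_ideal_span_X_image.mp h (Finsupp.single t 1) (by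
      rw [mem_support_iff, coeff_sum, Finset.sum_eq_single t]
      · simp
      · intro b _ hb
        rw [coeff_X, if_neg]
        simpa [Finsupp.single_left_inj] using hb
      · simp)
    exact hi (by_contra fun h' => hne (Finsupp.single_eq_of_ne (by rintro rfl; exact h' ht)))
  · obtain ⟨i, hi, hne⟩ := mem_ideal_span_X_image.mp h m hm
    exact hi (hmT (by simpa using hne))

theorem isIndepSet_compl_neighborSet_of_isClique {C : Set V}
    (hC : G.IsClique C) (hS : G.IsIndepSet Cᶜ) {w : V} (hw : w ∈ C) :
    G.IsIndepSet (G.neighborSet w)ᶜ := by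
  intro u hu v hv huv h
  have aux {z : V} (hz : z ∈ (G.neighborSet w)ᶜ) (hzC : z ∈ C) : z = w :=
    by_contra fun hne => hz (hC hw hzC (Ne.symm hne))
  by_cases huC : u ∈ C
  · obtain rfl := aux hu huC
    exact hv h
  · by_cases hvC : v ∈ C
    · obtain rfl := aux hv hvC
      exact hu h.symm
    · exact hS huC hvC huv h

/-- If the vertices split into a clique `C` and an independent set, then the depth of `R/I(G)` is
at least `p` as soon as `Cᶜ` and the non-neighborhoods of the vertices of `C` have at least
`p` elements. -/
theorem le_edgeRingDepth_of_isClique [Finite V] {C : Set V} {p : ℕ} (hC : G.IsClique C)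
    (hS : G.IsIndepSet Cᶜ) (hp : p ≤ Cᶜ.ncard) (hpC : ∀ w ∈ C, p ≤ (G.neighborSet w)ᶜ.ncard) :
    p ≤ edgeRingDepth K G := by
  classical
  have hle (s : Set V) : Ideal.span (X '' s) ≤ Ideal.span (Set.range (X : V → MvPolynomial V K)) :=
    Ideal.span_mono (Set.image_subset_range _ _)
  have hdepth (s : Set V) (hs : p ≤ sᶜ.ncard) : ∃ rs : List (MvPolynomial V K), p ≤ rs.length ∧
      (∀ r ∈ rs, r ∈ Ideal.span (Set.range X)) ∧
      RingTheory.Sequence.IsRegular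
        (MvPolynomial V K ⧸ (Ideal.span (X '' s) : Ideal (MvPolynomial V K))) rs := by
    obtain ⟨rs, h1, h2, h3⟩ := exists_isRegular_quotient_span_X_image (K := K) s
    exact ⟨rs, hs.trans h1.ge, h2, h3⟩
  have key (D : Finset V) : ↑D ⊆ C → ∃ rs : List (MvPolynomial V K), p ≤ rs.length ∧
      (∀ r ∈ rs, r ∈ Ideal.span (Set.range X)) ∧ RingTheory.Sequence.IsRegular
        (MvPolynomial V K ⧸
          (edgeIdeal K G ⊔ Ideal.span (X '' (C \ D)) : Ideal (MvPolynomial V K))) rs := by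
    induction D using Finset.induction_on with
    | empty =>
      intro _
      have h := edgeIdeal_le_span_X_image_compl (K := K) hS
      rw [compl_compl] at h
      rw [Finset.coe_empty, Set.sdiff_empty, sup_eq_right.mpr h]
      exact hdepth C hp
    | insert w D hwD ih =>
      intro hD
      rw [Finset.coe_insert, Set.insert_subset_iff] at hD
      refine exists_isRegular_quotient_of_colon (x := X w) (L := Ideal.span (X '' G.neighborSet w))
        span_range_X_ne_top (fun a => ⟨?_, fun ha => ?_⟩) (hle _)
        (sup_le edgeIdeal_le_span_range_X (hle _)) (Ideal.subset_span ⟨w, rfl⟩)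
        (hdepth _ (hpC w hD.1)) ?_
      · suffices h : Ideal.span (X '' G.neighborSet w) ≤ Submodule.comap
            (LinearMap.mulRight (MvPolynomial V K) (X w)) (edgeIdeal K G) from
          fun ha => Ideal.mem_sup_left (h ha)
        rw [Ideal.span_le]
        rintro _ ⟨v, hv, rfl⟩
        exact X_mul_X_mem_edgeIdeal ((show G.Adj w v from hv).symm)
      · have hJL : edgeIdeal K G ⊔ Ideal.span (X '' (C \ ↑(insert w D))) ≤
            Ideal.span (X '' G.neighborSet w) := by
          refine sup_le ?_ (Ideal.span_mono (Set.image_mono ?_))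
          · have h := edgeIdeal_le_span_X_image_compl (K := K)
              (isIndepSet_compl_neighborSet_of_isClique hC hS hD.1)
            rwa [compl_compl] at h
          · rintro v ⟨hvC, hv⟩
            exact hC hD.1 hvC (by rintro rfl; simp at hv)
        exact ((isPrime_span_X_image (G.neighborSet w)).mem_or_mem (hJL ha)).resolve_right fun h =>
          G.loopless.irrefl w (X_mem_span_X_image_iff.mp h)
      · have hset : C \ ↑D = (C \ ↑(insert w D)) ∪ {w} := by
          ext v
          by_cases hv : v = w
          · subst hv; simp [hwD, hD.1]
          · simp [hv]
        have hI := ih hD.2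
        rwa [hset, Set.image_union, Ideal.span_union, ← sup_assoc, Set.image_singleton] at hI
  obtain ⟨rs, hlen, hmem, hreg⟩ := key C.toFinite.toFinset (by simp)
  rw [Set.Finite.coe_toFinset, Set.sdiff_self, Set.image_empty, Ideal.span_empty,
    sup_bot_eq] at hreg
  exact hlen.trans (le_edgeRingDepth hmem hreg.toIsWeaklyRegular)

end Depth

section IndependentSets

variable {V : Type*} {G : SimpleGraph V}

open Finset in
/-- Let `S` be a maximum independent set in a graph without isolated vertices, and let `q ≤ |S|` be
such that every vertex outside `S` lies in an independent set of size at least `q`. Then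
`|S| ≤ |Sᶜ| * (|S| - q + 1)`. -/
theorem card_le_card_compl_mul_of_isIndepSet [Fintype V] [DecidableEq V]
    (hG : ∀ v, ∃ w, G.Adj v w) {S : Finset V} (hS : G.IsIndepSet (S : Set V))
    (hmax : ∀ T : Finset V, G.IsIndepSet (T : Set V) → #T ≤ #S) {q : ℕ} (hq : q ≤ #S)
    (hQ : ∀ w ∉ S, ∃ Q : Finset V, G.IsIndepSet (Q : Set V) ∧ w ∈ Q ∧ q ≤ #Q) :
    #S ≤ #Sᶜ * (#S - q + 1) := by
  classical
  let N (B : Finset V) : Finset V := {s ∈ S | ∃ b ∈ B, G.Adj s b}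
  have card_le_card_N {B : Finset V} (hB : G.IsIndepSet (B : Set V)) (hBS : Disjoint B S) :
      #B ≤ #(N B) := by
    have hind : G.IsIndepSet ((S \ N B ∪ B : Finset V) : Set V) := by
      intro u hu v hv huv h
      simp only [N, coe_union, coe_sdiff, Set.mem_union, Set.mem_sdiff, mem_coe, mem_filter,
        not_and, not_exists] at hu hv
      rcases hu with ⟨hu, hu'⟩ | hu <;> rcases hv with ⟨hv, hv'⟩ | hv
      · exact hS hu hv huv h
      · exact hu' hu v hv h
      · exact hv' hv u hu h.symm
      · exact hB hu hv huv h
    have h1 := hmax _ hind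
    have h2 : N B ⊆ S := filter_subset _ _
    rw [card_union_of_disjoint (hBS.symm.mono_left sdiff_subset), card_sdiff_of_subset h2] at h1
    have := card_le_card h2
    omega
  have key (W : Finset V) : W ⊆ Sᶜ → ∃ U ⊆ Sᶜ, W ⊆ U ∧ #(N U) ≤ #U * (#S - q + 1) := by
    induction W using Finset.induction_on with
    | empty => exact fun _ => ⟨∅, by simp, by simp, by simp [N]⟩
    | insert w W _ ih =>
      intro hW
      rw [insert_subset_iff] at hW
      obtain ⟨U, hUS, hWU, hU⟩ := ih hW.2
      by_cases hwU : w ∈ U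
      · exact ⟨U, hUS, insert_subset hwU hWU, hU⟩
      obtain ⟨Q, hQind, hwQ, hqQ⟩ := hQ w (mem_compl.mp hW.1)
      let A := Q \ S
      have hAS : Disjoint A S := sdiff_disjoint
      have hAind : G.IsIndepSet (A : Set V) := hQind.mono (by simp [A])
      have hwA : w ∈ A \ U := by simp [A, hwQ, hwU, mem_compl.mp hW.1]
      have hNA : #(N A) + #Q ≤ #S + #A := by
        have h1 : Disjoint (N A) (Q ∩ S) := by
          rw [Finset.disjoint_left]
          intro v hv hv'
          obtain ⟨-, b, hb, hvb⟩ := mem_filter.mp hv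
          exact hQind (mem_inter.mp hv').1 (mem_sdiff.mp hb).1 hvb.ne hvb
        have h2 : #(N A ∪ (Q ∩ S)) ≤ #S :=
          card_le_card (union_subset (filter_subset _ _) inter_subset_right)
        rw [card_union_of_disjoint h1] at h2
        have h3 : #A + #(Q ∩ S) = #Q := card_sdiff_add_card_inter Q S
        omega
      have hNsub : N (A ∩ U) ⊆ N A := by
        intro v hv
        obtain ⟨hvS, b, hb, hvb⟩ := mem_filter.mp hv
        exact mem_filter.mpr ⟨hvS, b, (mem_inter.mp hb).1, hvb⟩
      have hcover : N (U ∪ A) ⊆ N U ∪ (N A \ N (A ∩ U)) := by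
        intro v hv
        obtain ⟨hvS, b, hb, hvb⟩ := mem_filter.mp hv
        have hN {B : Finset V} (hbB : b ∈ B) : v ∈ N B := mem_filter.mpr ⟨hvS, b, hbB, hvb⟩
        by_cases hvU : v ∈ N U
        · exact mem_union_left _ hvU
        have hbA : b ∈ A := (mem_union.mp hb).resolve_left fun hbU => hvU (hN hbU)
        refine mem_union_right _ (mem_sdiff.mpr ⟨hN hbA, fun h => hvU ?_⟩)
        obtain ⟨-, b', hb', hvb'⟩ := mem_filter.mp h
        exact mem_filter.mpr ⟨hvS, b', (mem_inter.mp hb').2, hvb'⟩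
      have hNU := (card_le_card hcover).trans (card_union_le _ _)
      rw [card_sdiff_of_subset hNsub] at hNU
      have hAU : #(A ∩ U) ≤ #(N (A ∩ U)) :=
        card_le_card_N (hAind.mono (by simp)) (hAS.mono_left inter_subset_left)
      have hA : #(A \ U) + #(A ∩ U) = #A := card_sdiff_add_card_inter A U
      have hpos : 0 < #(A \ U) := card_pos.mpr ⟨w, hwA⟩
      have hUA : #(U ∪ A) = #U + #(A \ U) := by
        rw [← union_sdiff_self_eq_union, card_union_of_disjoint disjoint_sdiff]
      refine ⟨U ∪ A, union_subset hUS fun v hv => mem_compl.mpr (mem_sdiff.mp hv).2,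
        insert_subset (mem_union_right _ (mem_sdiff.mp hwA).1)
          (hWU.trans subset_union_left), ?_⟩
      rw [hUA, add_mul]
      obtain ⟨e, he⟩ := Nat.exists_eq_add_of_le hq
      rw [show #S - q = e by omega] at *
      obtain ⟨a, ha⟩ := Nat.exists_eq_add_of_le' hpos
      have : #(N A) - #(N (A ∩ U)) ≤ e + #(A \ U) := by omega
      have : e + #(A \ U) ≤ #(A \ U) * (e + 1) := by rw [ha]; nlinarith [Nat.zero_le (a * e)]
      omega
  obtain ⟨U, hUS, hSU, hU⟩ := key Sᶜ subset_rfl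
  obtain rfl := hUS.antisymm hSU
  refine le_trans (card_le_card fun s hs => ?_) hU
  obtain ⟨w, hw⟩ := hG s
  exact mem_filter.mpr ⟨hs, w, mem_compl.mpr fun hwS => hS hs hwS hw.ne hw, hw⟩

end IndependentSets

section IntervalSplitGraph

/-- The first `d` vertices are independent, the others form a clique, and the vertex `d + i` is
adjacent to the `k` consecutive vertices starting at `min (i * k) (d - k)`. -/
def intervalSplitGraph (n d k : ℕ) : SimpleGraph (Fin n) :=
  SimpleGraph.fromRel fun u v : Fin n => d ≤ (v : ℕ) ∧
    (d ≤ (u : ℕ) ∨ min ((v - d) * k) (d - k) ≤ (u : ℕ) ∧ (u : ℕ) < min ((v - d) * k) (d - k) + k)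

variable {n d k : ℕ}

theorem intervalSplitGraph_adj_of_lt_of_le {u v : Fin n} (hu : (u : ℕ) < d) (hv : d ≤ (v : ℕ)) :
    (intervalSplitGraph n d k).Adj u v ↔
      min ((v - d) * k) (d - k) ≤ (u : ℕ) ∧ (u : ℕ) < min ((v - d) * k) (d - k) + k := by
  have huv : u ≠ v := by rintro rfl; omega
  rw [intervalSplitGraph, SimpleGraph.fromRel_adj]
  simp [huv, hv, not_le.mpr hu]

theorem isClique_intervalSplitGraph : (intervalSplitGraph n d k).IsClique {v | d ≤ (v : ℕ)} :=
  fun _ hu _ hv huv => ⟨huv, Or.inl ⟨hv, Or.inl hu⟩⟩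

theorem isIndepSet_intervalSplitGraph :
    (intervalSplitGraph n d k).IsIndepSet {v | (v : ℕ) < d} := by
  rintro u hu v hv - ⟨-, h | h⟩
  · exact absurd h.1 (not_le.mpr hv)
  · exact absurd h.1 (not_le.mpr hu)

theorem exists_adj_intervalSplitGraph (hd : d < n) (hk : 1 ≤ k) (hkd : k ≤ d)
    (hdk : d ≤ (n - d) * k) {u : Fin n} (hu : (u : ℕ) < d) :
    ∃ v : Fin n, d ≤ (v : ℕ) ∧ (intervalSplitGraph n d k).Adj u v := by
  have hi : (u : ℕ) / k < n - d := Nat.div_lt_of_lt_mul (by rw [mul_comm]; omega)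
  refine ⟨⟨d + u / k, by omega⟩, Nat.le_add_right _ _, ?_⟩
  rw [intervalSplitGraph_adj_of_lt_of_le hu (Nat.le_add_right _ _)]
  have h1 := Nat.div_mul_le_self u k
  have h2 := Nat.lt_div_mul_add (a := u) hk
  simp only [Nat.add_sub_cancel_left]
  omega

theorem connected_intervalSplitGraph (hd : d < n) (hk : 1 ≤ k) (hkd : k ≤ d)
    (hdk : d ≤ (n - d) * k) : (intervalSplitGraph n d k).Connected := by
  have hclique (v : Fin n) (hv : d ≤ (v : ℕ)) :
      (intervalSplitGraph n d k).Reachable v ⟨d, hd⟩ := by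
    by_cases h : v = ⟨d, hd⟩
    · rw [h]
    · exact (isClique_intervalSplitGraph hv (le_refl d) h).reachable
  have hall (v : Fin n) : (intervalSplitGraph n d k).Reachable v ⟨d, hd⟩ := by
    rcases lt_or_ge (v : ℕ) d with hv | hv
    · obtain ⟨w, hw, hvw⟩ := exists_adj_intervalSplitGraph hd hk hkd hdk hv
      exact hvw.reachable.trans (hclique w hw)
    · exact hclique v hv
  exact (SimpleGraph.connected_iff _).mpr
    ⟨fun u v => (hall u).trans (hall v).symm, ⟨⟨d, hd⟩⟩⟩

theorem ncard_setOf_le_and_lt {a : ℕ} (h : a + k ≤ n) :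
    {v : Fin n | a ≤ (v : ℕ) ∧ (v : ℕ) < a + k}.ncard = k := by
  have hset : {v : Fin n | a ≤ (v : ℕ) ∧ (v : ℕ) < a + k} =
      Set.range fun i : Fin k => (⟨a + i, by omega⟩ : Fin n) := by
    ext v
    refine ⟨fun hv => ⟨⟨v - a, by have := hv.1; have := hv.2; omega⟩, ?_⟩, ?_⟩
    · ext; exact Nat.add_sub_cancel' hv.1
    · rintro ⟨i, rfl⟩
      exact ⟨Nat.le_add_right _ _, Nat.add_lt_add_left i.2 a⟩
  rw [hset, ← Set.image_univ, Set.ncard_image_of_injective, Set.ncard_univ, Nat.card_fin]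
  intro i j hij
  simpa [Fin.ext_iff] using hij

theorem ncard_setOf_lt (hd : d ≤ n) : {v : Fin n | (v : ℕ) < d}.ncard = d := by
  simpa using ncard_setOf_le_and_lt (a := 0) (k := d) (n := n) (by omega)

theorem compl_neighborSet_intervalSplitGraph {w : Fin n} (hw : d ≤ (w : ℕ)) :
    ((intervalSplitGraph n d k).neighborSet w)ᶜ = insert w ({v : Fin n | (v : ℕ) < d} \
      {v : Fin n | min ((w - d) * k) (d - k) ≤ (v : ℕ) ∧
        (v : ℕ) < min ((w - d) * k) (d - k) + k}) := by
  ext v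
  rcases lt_or_ge (v : ℕ) d with hv | hv
  · have hvw : v ≠ w := by rintro rfl; omega
    rw [Set.mem_compl_iff, SimpleGraph.mem_neighborSet, SimpleGraph.adj_comm,
      intervalSplitGraph_adj_of_lt_of_le hv hw]
    simp only [Set.mem_insert_iff, hvw, false_or, Set.mem_sdiff, Set.mem_ofPred_eq, hv, true_and]
  · by_cases hvw : v = w
    · simp [hvw]
    · have := isClique_intervalSplitGraph (k := k) hw hv (Ne.symm hvw)
      simp [hvw, this, hv]

theorem ncard_compl_neighborSet_intervalSplitGraph (hd : d ≤ n) (hkd : k ≤ d) {w : Fin n}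
    (hw : d ≤ (w : ℕ)) : ((intervalSplitGraph n d k).neighborSet w)ᶜ.ncard = d - k + 1 := by
  rw [compl_neighborSet_intervalSplitGraph hw, Set.ncard_insert_of_notMem (by simp [hw]),
    Set.ncard_sdiff (fun v hv => by simp at hv ⊢; omega), ncard_setOf_lt hd,
    ncard_setOf_le_and_lt (by omega)]

theorem ncard_le_of_isIndepSet_intervalSplitGraph (hd : d ≤ n) (hk : 1 ≤ k) (hkd : k ≤ d)
    {T : Set (Fin n)} (hT : (intervalSplitGraph n d k).IsIndepSet T) : T.ncard ≤ d := by
  by_cases h : ∃ w ∈ T, d ≤ (w : ℕ)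
  · obtain ⟨w, hwT, hw⟩ := h
    have hsub : T ⊆ ((intervalSplitGraph n d k).neighborSet w)ᶜ :=
      fun v hv (hwv : SimpleGraph.Adj _ w v) => hT hwT hv hwv.ne hwv
    have := Set.ncard_le_ncard hsub
    rw [ncard_compl_neighborSet_intervalSplitGraph hd hkd hw] at this
    omega
  · push Not at h
    exact (Set.ncard_le_ncard h).trans_eq (ncard_setOf_lt hd)

end IntervalSplitGraph

section DimDepth

variable (K : Type*) [Field K]

open Finset in
theorem le_mul_of_connected {V : Type*} [Fintype V] [DecidableEq V] [Nontrivial V]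
    {G : SimpleGraph V} (hG : G.Connected) {d : ℕ}
    (hd : ringKrullDim (MvPolynomial V K ⧸ edgeIdeal K G) = (d : WithBot ℕ∞)) :
    edgeRingDepth K G ≤ d ∧ d < Fintype.card V ∧
      d ≤ (Fintype.card V - d) * (d - edgeRingDepth K G + 1) := by
  obtain ⟨S, hS, hmax⟩ := exists_isIndepSet_forall_ncard_le G
  rw [ringKrullDim_quotient_edgeIdeal hS hmax] at hd
  have hSd : S.ncard = d := by exact_mod_cast hd
  lift S to Finset V using S.toFinite
  rw [Set.ncard_coe_finset] at hSd hmax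
  have hadj (v : V) : ∃ w, G.Adj v w := hG.preconnected.exists_adj_of_nontrivial v
  have hQ (w : V) : ∃ Q : Finset V, G.IsIndepSet (Q : Set V) ∧ w ∈ Q ∧ edgeRingDepth K G ≤ #Q := by
    obtain ⟨Q, hwQ, hQ, hdom⟩ := exists_superset_isIndepSet_dominating
      (G := G) (T := {w}) (Set.pairwise_singleton _ _)
    lift Q to Finset V using Q.toFinite
    exact ⟨Q, hQ, by simpa using hwQ, (edgeRingDepth_le_ncard hQ hdom).trans_eq
      (Set.ncard_coe_finset Q)⟩
  have hmax' (T : Finset V) (hT : G.IsIndepSet (T : Set V)) : #T ≤ #S :=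
    (Set.ncard_coe_finset T).symm.trans_le (hmax T hT)
  obtain ⟨v⟩ := hG.nonempty
  obtain ⟨w, hvw⟩ := hadj v
  obtain ⟨Q, hQind, -, hpQ⟩ := hQ v
  have hp : edgeRingDepth K G ≤ #S := hpQ.trans (hmax' Q hQind)
  subst hSd
  refine ⟨hp, lt_of_le_of_ne (card_le_univ S) fun h => ?_, ?_⟩
  · obtain rfl := (card_eq_iff_eq_univ S).mp h
    exact hS (by simp) (by simp) hvw.ne hvw
  · rw [← card_compl]
    exact card_le_card_compl_mul_of_isIndepSet hadj hS hmax' hp fun w _ => hQ w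

theorem exists_connected_of_le_mul {n d p : ℕ} (hp : 1 ≤ p) (hpd : p ≤ d) (hd : d < n)
    (h : d ≤ (n - d) * (d - p + 1)) :
    ∃ G : SimpleGraph (Fin n), G.Connected ∧
      ringKrullDim (MvPolynomial (Fin n) K ⧸ edgeIdeal K G) = (d : WithBot ℕ∞) ∧
        edgeRingDepth K G = p := by
  have hk : 1 ≤ d - p + 1 := by omega
  have hkd : d - p + 1 ≤ d := by omega
  have hcompl : {v : Fin n | d ≤ (v : ℕ)}ᶜ = {v : Fin n | (v : ℕ) < d} := by ext; simp
  have hC := isClique_intervalSplitGraph (n := n) (d := d) (k := d - p + 1)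
  have hS := isIndepSet_intervalSplitGraph (n := n) (d := d) (k := d - p + 1)
  have hcard {w : Fin n} (hw : d ≤ (w : ℕ)) :=
    (ncard_compl_neighborSet_intervalSplitGraph hd.le hkd hw).trans
      (show d - (d - p + 1) + 1 = p by omega)
  refine ⟨intervalSplitGraph n d (d - p + 1), connected_intervalSplitGraph hd hk hkd h, ?_,
    le_antisymm ?_ (le_edgeRingDepth_of_isClique hC ?_ ?_ fun w hw => (hcard hw).ge)⟩
  · rw [ringKrullDim_quotient_edgeIdeal hS fun T hT => ?_, ncard_setOf_lt hd.le]
    rw [ncard_setOf_lt hd.le]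
    exact ncard_le_of_isIndepSet_intervalSplitGraph hd.le hk hkd hT
  · have hw : d ≤ ((⟨d, hd⟩ : Fin n) : ℕ) := le_rfl
    refine (edgeRingDepth_le_ncard (isIndepSet_compl_neighborSet_of_isClique hC (hcompl ▸ hS) hw)
      fun v hv => ⟨⟨d, hd⟩, ?_, ?_⟩).trans_eq (hcard hw)
    · simp
    · exact (not_not.mp hv : (intervalSplitGraph n d (d - p + 1)).Adj ⟨d, hd⟩ v).symm
  · rwa [hcompl]
  · rwa [hcompl, ncard_setOf_lt hd.le]

end DimDepth

/-- Corollary 1.7: for `n ≥ 3`, the pairs `(dim R/I(G), depth R/I(G))` realized by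
connected graphs `G` on `n` vertices are exactly the pairs `(d, p)` with
`1 ≤ p ≤ d ≤ n - 1` and `d ≤ (n - d)(d - p + 1)`. -/
theorem graph_dim_depth_iff (K : Type*) [Field K] (n : ℕ) (hn : 3 ≤ n) (d p : ℕ) :
    (∃ G : SimpleGraph (Fin n), G.Connected ∧
        ringKrullDim (MvPolynomial (Fin n) K ⧸ edgeIdeal K G) = (d : WithBot (WithTop ℕ)) ∧
        edgeRingDepth K G = p) ↔
      (1 ≤ p ∧ p ≤ d ∧ d ≤ n - 1 ∧ d ≤ (n - d) * (d - p + 1)) := by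
  constructor
  · rintro ⟨G, hG, hd, rfl⟩
    have : Nontrivial (Fin n) := Fin.nontrivial_iff_two_le.mpr (by omega)
    obtain ⟨hpd, hdn, h⟩ := le_mul_of_connected K hG hd
    rw [Fintype.card_fin] at hdn h
    exact ⟨one_le_edgeRingDepth, hpd, by omega, h⟩
  · rintro ⟨hp, hpd, hdn, h⟩
    exact exists_connected_of_le_mul K hp hpd (by omega) h
end

section
/- Let G be a finite simple connected graph on n ≥ 3 vertices. Then α(G) ≤ (n − α(G)) · (α(G) − i(G) + 1), where α(G) is the maximum cardinality of an independent set of G and i(G) is the minimum cardinality of a maximal independent set of G. -/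
/-- `α(G)`: the maximum cardinality of an independent set of `G`. -/
noncomputable def indepNum {V : Type*} (G : SimpleGraph V) : ℕ :=
  sSup {n | ∃ S : Set V, IsIndep G S ∧ S.ncard = n}

section IndependentSets

variable {V : Type*} {G : SimpleGraph V}

theorem IsIndep.mono {S T : Set V} (hT : IsIndep G T) (h : S ⊆ T) : IsIndep G S :=
  Set.Pairwise.mono h hT

theorem bddAbove_ncard_isIndep [Fintype V] (G : SimpleGraph V) :
    BddAbove {n | ∃ S : Set V, IsIndep G S ∧ S.ncard = n} := by
  refine ⟨Nat.card V, ?_⟩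
  rintro _ ⟨S, -, rfl⟩
  exact Set.ncard_le_card S

theorem exists_isIndep_card_eq_indepNum [Fintype V] (G : SimpleGraph V) :
    ∃ A : Finset V, IsIndep G (A : Set V) ∧ A.card = indepNum G := by
  classical
  obtain ⟨S, hS, hcard⟩ := Nat.sSup_mem
    (s := {n | ∃ S : Set V, IsIndep G S ∧ S.ncard = n})
    ⟨0, ∅, by simp [IsIndep], by simp⟩ (bddAbove_ncard_isIndep G)
  refine ⟨S.toFinset, by simpa using hS, ?_⟩
  rw [← Set.ncard_eq_toFinset_card', hcard, indepNum]

theorem IsIndep.card_le_indepNum [Fintype V] {A : Finset V} (hA : IsIndep G (A : Set V)) :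
    A.card ≤ indepNum G :=
  le_csSup (bddAbove_ncard_isIndep G) ⟨A, hA, Set.ncard_coe_finset A⟩

theorem IsMaxIndep.indepDomNum_le_card [Fintype V] {A : Finset V} (hA : IsMaxIndep G (A : Set V)) :
    indepDomNum G ≤ A.card :=
  Nat.sInf_le ⟨A, hA, Set.ncard_coe_finset A⟩

open Classical in
/-- The vertices of `A` that have a neighbour in `S`. -/
noncomputable def neighborsIn (G : SimpleGraph V) (A S : Finset V) : Finset V :=
  A.filter fun z => ∃ s ∈ S, G.Adj s z

theorem mem_neighborsIn {A S : Finset V} {z : V} :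
    z ∈ neighborsIn G A S ↔ z ∈ A ∧ ∃ s ∈ S, G.Adj s z := by
  simp [neighborsIn]

theorem neighborsIn_subset (A S : Finset V) : neighborsIn G A S ⊆ A :=
  fun _ hz => (mem_neighborsIn.1 hz).1

theorem neighborsIn_mono {A S T : Finset V} (h : S ⊆ T) :
    neighborsIn G A S ⊆ neighborsIn G A T := by
  intro z hz
  obtain ⟨hzA, s, hs, hsz⟩ := mem_neighborsIn.1 hz
  exact mem_neighborsIn.2 ⟨hzA, s, h hs, hsz⟩

variable [DecidableEq V]

/-- An independent set can be exchanged into `A` in place of its neighbours in `A`. -/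
theorem IsIndep.union_sdiff_neighborsIn {A B : Finset V} (hA : IsIndep G (A : Set V))
    (hB : IsIndep G (B : Set V)) :
    IsIndep G ((B ∪ A \ neighborsIn G A B : Finset V) : Set V) := by
  intro x hx y hy hxy hadj
  simp only [Finset.coe_union, Set.mem_union, Finset.mem_coe, Finset.mem_sdiff,
    mem_neighborsIn] at hx hy
  rcases hx with hx | ⟨hxA, hx⟩ <;> rcases hy with hy | ⟨hyA, hy⟩
  · exact hB hx hy hxy hadj
  · exact hy ⟨hyA, x, hx, hadj⟩
  · exact hx ⟨hxA, y, hy, hadj.symm⟩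
  · exact hA hxA hyA hxy hadj

theorem card_union_sdiff_neighborsIn {A B : Finset V} (h : Disjoint B A) :
    (B ∪ A \ neighborsIn G A B).card + (neighborsIn G A B).card = B.card + A.card := by
  rw [Finset.card_union_of_disjoint (h.mono_right Finset.sdiff_subset), add_assoc,
    Finset.card_sdiff_add_card_eq_card (neighborsIn_subset A B)]

theorem IsIndep.card_le_card_neighborsIn [Fintype V] {A B : Finset V} (hA : IsIndep G (A : Set V))
    (hmax : A.card = indepNum G) (hB : IsIndep G (B : Set V)) (h : Disjoint B A) :
    B.card ≤ (neighborsIn G A B).card := by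
  have h1 := (hA.union_sdiff_neighborsIn hB).card_le_indepNum
  have h2 := card_union_sdiff_neighborsIn (G := G) h
  omega

theorem IsIndep.card_neighborsIn_le [Fintype V] {A B : Finset V} (hA : IsIndep G (A : Set V))
    (hmax : A.card = indepNum G) (hB : IsIndep G (B : Set V)) (h : Disjoint B A)
    (hdom : ∀ w ∉ A, w ∉ B → ∃ b ∈ B, G.Adj b w) :
    (neighborsIn G A B).card ≤ B.card + (indepNum G - indepDomNum G) := by
  have hM : IsMaxIndep G ((B ∪ A \ neighborsIn G A B : Finset V) : Set V) := by
    refine ⟨hA.union_sdiff_neighborsIn hB, fun T hT hsub => hsub.antisymm fun w hw => ?_⟩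
    by_contra hw'
    simp only [Finset.coe_union, Set.mem_union, Finset.mem_coe, Finset.mem_sdiff,
      mem_neighborsIn, not_or, not_and] at hw'
    obtain ⟨b, hb, hadj⟩ : ∃ b ∈ B, G.Adj b w := by
      by_cases hwA : w ∈ A
      · by_contra h'
        exact hw'.2 hwA fun _ => h'
      · exact hdom w hwA hw'.1
    exact hT (hsub (Finset.mem_coe.2 (Finset.mem_union_left _ hb))) hw hadj.ne hadj
  have h1 := hM.indepDomNum_le_card
  have h2 := card_union_sdiff_neighborsIn (G := G) h
  omega

/-- A vertex outside `A` lies in a maximal independent set of the graph induced on `Aᶜ`. -/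
theorem exists_isIndep_dominating_compl [Fintype V] {A : Finset V} {v : V} (hv : v ∉ A) :
    ∃ B : Finset V, v ∈ B ∧ Disjoint B A ∧ IsIndep G (B : Set V) ∧
      ∀ w ∉ A, w ∉ B → ∃ b ∈ B, G.Adj b w := by
  obtain ⟨B, hB⟩ := (Set.toFinite {B : Finset V | v ∈ B ∧ Disjoint B A ∧
    IsIndep G (B : Set V)}).exists_maximal ⟨{v}, by simp [hv, IsIndep]⟩
  obtain ⟨hvB, hBA, hBi⟩ := hB.prop
  refine ⟨B, hvB, hBA, hBi, fun w hwA hwB => ?_⟩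
  by_contra! hw
  refine hwB (hB.le_of_ge (y := insert w B) ⟨Finset.mem_insert_of_mem hvB, ?_, ?_⟩
    (Finset.subset_insert w B) (Finset.mem_insert_self w B))
  · simp [hwA, hBA]
  · rw [Finset.coe_insert]
    exact hBi.insert fun b hb _ => ⟨fun h => hw b hb h.symm, hw b hb⟩

/-- If every vertex of a maximum independent set `A` has a neighbour, then the vertices of `A`
without neighbours in `S` are few compared to the vertices outside `A` and `S`. -/
theorem IsIndep.card_sdiff_neighborsIn_le [Fintype V] {A : Finset V} (hA : IsIndep G (A : Set V))
    (hmax : A.card = indepNum G) (hnbr : ∀ z ∈ A, ∃ w, G.Adj w z) (S : Finset V) :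
    (A \ neighborsIn G A S).card ≤ (Aᶜ \ S).card * (indepNum G - indepDomNum G + 1) := by
  induction hk : (Aᶜ \ S).card using Nat.strong_induction_on generalizing S with
  | _ k ih =>
  subst hk
  rcases (Aᶜ \ S).eq_empty_or_nonempty with hempty | ⟨v, hv⟩
  · rw [Finset.sdiff_eq_empty_iff_subset] at hempty
    have hsub : A \ neighborsIn G A S = ∅ := by
      rw [Finset.sdiff_eq_empty_iff_subset]
      intro z hz
      obtain ⟨w, hw⟩ := hnbr z hz
      have hwA : w ∉ A := fun hwA => hA hwA hz hw.ne hw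
      exact mem_neighborsIn.2 ⟨hz, w, hempty (Finset.mem_compl.2 hwA), hw⟩
    simp [hsub]
  · obtain ⟨hvA, hvS⟩ := Finset.mem_sdiff.1 hv
    obtain ⟨B, hvB, hBA, hBi, hdom⟩ :=
      exists_isIndep_dominating_compl (G := G) (Finset.mem_compl.1 hvA)
    have hsplit : (Aᶜ \ (S ∪ B)).card + (B \ S).card = (Aᶜ \ S).card := by
      rw [← Finset.card_union_of_disjoint]
      · congr 1
        ext x
        have : x ∈ B → x ∉ A := fun hx => Finset.disjoint_left.1 hBA hx
        simp only [Finset.mem_union, Finset.mem_sdiff, Finset.mem_compl]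
        tauto
      · rw [Finset.disjoint_left]
        simp only [Finset.mem_union, Finset.mem_sdiff]
        tauto
    have hpos : 0 < (B \ S).card := Finset.card_pos.2 ⟨v, Finset.mem_sdiff.2 ⟨hvB, hvS⟩⟩
    have hrec := ih _ (by omega) (S ∪ B) rfl
    have hupper := hA.card_neighborsIn_le hmax hBi hBA hdom
    have hlower := hA.card_le_card_neighborsIn hmax (B := B ∩ S)
      (hBi.mono (by simp)) (hBA.mono_left Finset.inter_subset_left)
    have hcover : A \ neighborsIn G A S ⊆ (A \ neighborsIn G A (S ∪ B)) ∪
        (neighborsIn G A B \ neighborsIn G A (B ∩ S)) := by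
      intro z hz
      simp only [Finset.mem_union, Finset.mem_sdiff, Finset.mem_inter, mem_neighborsIn] at hz ⊢
      grind
    have hcard := (Finset.card_le_card hcover).trans (Finset.card_union_le _ _)
    have hdiff := Finset.card_sdiff_add_card_eq_card
      (neighborsIn_mono (G := G) (A := A) (Finset.inter_subset_left (s₁ := B) (s₂ := S)))
    have hB := Finset.card_sdiff_add_card_inter B S
    rw [← hsplit, add_mul]
    nlinarith [Nat.zero_le (indepNum G - indepDomNum G)]

end IndependentSets

/-- For a finite simple connected graph `G` on `n ≥ 3` vertices,
`α(G) ≤ (n - α(G)) * (α(G) - i(G) + 1)`. -/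
theorem indepNum_le_mul
    {V : Type*} [Fintype V] (G : SimpleGraph V) (hconn : G.Connected)
    (hcard : 3 ≤ Fintype.card V) :
    indepNum G ≤ (Fintype.card V - indepNum G) * (indepNum G - indepDomNum G + 1) := by
  classical
  obtain ⟨A, hA, hmax⟩ := exists_isIndep_card_eq_indepNum G
  have : Nontrivial V := Fintype.one_lt_card_iff_nontrivial.1 (by omega)
  have hnbr (z : V) (_ : z ∈ A) : ∃ w, G.Adj w z := by
    obtain ⟨w, hw⟩ := hconn.preconnected.exists_adj_of_nontrivial z
    exact ⟨w, hw.symm⟩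
  simpa [neighborsIn, Finset.card_compl, hmax] using hA.card_sdiff_neighborsIn_le hmax hnbr ∅
end

section
/- Let G be a finite simple graph and let U be the set of vertices of G that belong to some maximum independent set (an independent set of maximum cardinality α(G)). Let v ∈ U be a vertex whose degree is minimal among all vertices of U. If v' is a vertex of G with v' ∉ N[v] and N_G(v') ⊆ N_G(v), and v' belongs to the vertex set of G, then N_G(v') = N_G(v). -/
theorem IsIndep.ncard_le_indepNum {V : Type*} [Finite V] {G : SimpleGraph V} {S : Set V}
    (hS : IsIndep G S) : S.ncard ≤ indepNum G := by
  refine le_csSup ⟨Nat.card V, ?_⟩ ⟨S, hS, rfl⟩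
  rintro _ ⟨T, -, rfl⟩
  exact Set.ncard_le_card T

/-- A vertex whose neighbors are all neighbors of a vertex of an independent set may be added
to that set. -/
theorem IsIndep.insert_of_neighborSet_subset {V : Type*} {G : SimpleGraph V} {S : Set V}
    (hS : IsIndep G S) {v w : V} (hv : v ∈ S) (hsub : G.neighborSet w ⊆ G.neighborSet v) :
    IsIndep G (insert w S) := by
  have hw : ∀ s ∈ S, ¬ G.Adj w s := fun s hs hadj =>
    have hvs : G.Adj v s := hsub hadj
    hS hv hs hvs.ne hvs
  exact Set.pairwise_insert.2 ⟨hS, fun s hs _ => ⟨hw s hs, fun h => hw s hs h.symm⟩⟩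

/-- Let `v` be a vertex of minimal degree among the vertices belonging to some maximum
independent set of `G`. If `v'` is a vertex with `v' ∉ N[v]` and `N(v') ⊆ N(v)`, then
`N(v') = N(v)`. -/
theorem neighborSet_eq_of_subset
    {V : Type*} [Fintype V] (G : SimpleGraph V) (v : V)
    (hv : ∃ S : Set V, IsIndep G S ∧ S.ncard = indepNum G ∧ v ∈ S)
    (hmin : ∀ u : V, (∃ S : Set V, IsIndep G S ∧ S.ncard = indepNum G ∧ u ∈ S) →
      (G.neighborSet v).ncard ≤ (G.neighborSet u).ncard)
    (v' : V) (hv' : v' ∉ G.neighborSet v ∪ {v})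
    (hsub : G.neighborSet v' ⊆ G.neighborSet v) :
    G.neighborSet v' = G.neighborSet v := by
  obtain ⟨S, hS, hcard, hvS⟩ := hv
  have hmem : v' ∈ S := by
    by_contra hnot
    have hle := (hS.insert_of_neighborSet_subset hvS hsub).ncard_le_indepNum
    rw [Set.ncard_insert_of_notMem hnot] at hle
    omega
  exact Set.eq_of_subset_of_ncard_le hsub (hmin v' ⟨S, hS, hcard, hmem⟩)
end

section
/- Let G be a finite simple connected graph with at least 3 vertices, let U be the set of vertices of G that belong to some maximum independent set (an independent set of maximum cardinality α(G)), and let v ∈ U be a vertex whose degree is minimal among all vertices of U. Then the induced subgraph G − v on V(G) \ {v} has no isolated vertices. -/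
/-- In a connected graph, a nonempty set of vertices closed under adjacency contains every
vertex. -/
theorem SimpleGraph.Connected.mem_of_adj_closed {V : Type*} {G : SimpleGraph V}
    (hG : G.Connected) {C : Set V} (hC : ∀ a ∈ C, ∀ b, G.Adj a b → b ∈ C)
    {a : V} (ha : a ∈ C) (b : V) : b ∈ C := by
  obtain ⟨p⟩ := hG.preconnected a b
  induction p with
  | nil => exact ha
  | cons h _ ih => exact ih (hC _ ha _ h)

/-- Exchanging a vertex `v` of an independent set for a vertex with no neighbor other than `v`
yields an independent set. -/
theorem IsIndep.exchange {V : Type*} {G : SimpleGraph V} {S : Set V} (hS : IsIndep G S)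
    {v w : V} (hw : ∀ u, G.Adj w u → u = v) : IsIndep G (insert w (S \ {v})) := by
  rintro a (rfl | ⟨ha, hav⟩) b (rfl | ⟨hb, hbv⟩) hab h
  · exact hab rfl
  · exact hbv (hw b h)
  · exact hav (hw a h.symm)
  · exact hS ha hb hab h

/-- Let `G` be a finite simple connected graph with at least 3 vertices and let `v` be a
vertex of minimal degree among the vertices belonging to some maximum independent set of
`G`. Then the induced subgraph `G - v` on `V(G) \\ {v}` has no isolated vertices. -/
theorem delete_vertex_no_isolated
    {V : Type*} [Fintype V] (G : SimpleGraph V) (hconn : G.Connected)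
    (hcard : 3 ≤ Fintype.card V) (v : V)
    (hv : ∃ S : Set V, IsIndep G S ∧ S.ncard = indepNum G ∧ v ∈ S)
    (hmin : ∀ u : V, (∃ S : Set V, IsIndep G S ∧ S.ncard = indepNum G ∧ u ∈ S) →
      (G.neighborSet v).ncard ≤ (G.neighborSet u).ncard) :
    ∀ w : ↑({v}ᶜ : Set V), ∃ u : ↑({v}ᶜ : Set V), (G.induce ({v}ᶜ : Set V)).Adj w u := by
  rintro ⟨w, hwv⟩
  by_contra hiso
  have hw : ∀ u, G.Adj w u → u = v := by
    intro u hu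
    by_contra huv
    exact hiso ⟨⟨u, huv⟩, hu⟩
  have hvw : G.Adj w v := by
    by_contra hvw
    refine hwv (hconn.mem_of_adj_closed (C := {w}) ?_ rfl v).symm
    rintro a rfl b hab
    exact absurd (hw b hab ▸ hab) hvw
  obtain ⟨S, hS, hScard, hvS⟩ := hv
  have hwS : w ∉ S := fun h => hS h hvS hwv hvw
  have hdeg := hmin w
    ⟨insert w (S \ {v}), hS.exchange hw, by rw [Set.ncard_exchange hwS hvS, hScard], by simp⟩
  have hNw : G.neighborSet w = {v} := Set.ext fun u => ⟨hw u, by rintro rfl; exact hvw⟩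
  rw [hNw, Set.ncard_singleton] at hdeg
  have hv_adj : ∀ u, G.Adj v u → u = w := fun u hu =>
    (Set.ncard_le_one (Set.toFinite _)).mp hdeg u hu w hvw.symm
  have huniv : (Set.univ : Set V) ⊆ {v, w} := by
    intro x _
    refine hconn.mem_of_adj_closed (a := v) ?_ (by simp) x
    rintro a (rfl | rfl) b hab
    · exact Or.inr (hv_adj b hab)
    · exact Or.inl (hw b hab)
  have hle := (Set.ncard_le_ncard huniv).trans (Set.ncard_insert_le v {w})
  rw [Set.ncard_univ, Nat.card_eq_fintype_card, Set.ncard_singleton] at hle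
  omega
end
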